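/- arXiv:0810.4220 — 2 statements merged into one kernel-verified Lean document; each statement's English description precedes it below -/
import Mathlib

section
/- Yang–Baxter equation for the A^{(1)}_{n−1} face weights: for all a, b, c, d, e, f ∈ P and generic v₁, v₂ ∈ ℂ, Σ_{g∈P} W[d,e;c,g | v₁] · W[c,g;b,a | v₂] · W[e,f;g,a | v₁−v₂] = Σ_{g∈P} W[g,f;b,a | v₁] · W[d,e;g,f | v₂] · W[d,g;c,b | v₁−v₂], where both sums are finite because W vanishes on non-admissible configurations. -/
noncomputable section

/-- The q-Pochhammer infinite product `(z; q)_∞ = ∏_{k ≥ 0} (1 - z q^k)`. -/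
def qPochC (z q : ℂ) : ℂ := ∏' k : ℕ, (1 - z * q ^ k)

/-- `Θ_q(z) = (z;q)_∞ (q z⁻¹;q)_∞ (q;q)_∞`. -/
def thetaC (q z : ℂ) : ℂ := qPochC z q * qPochC (q * z⁻¹) q * qPochC q q

/-- The elliptic symbol `[v] = x^(v²/r - v) Θ_{x^{2r}}(x^{2v})`. -/
def ebrk (x r : ℝ) (v : ℂ) : ℂ :=
  (x : ℂ) ^ (v ^ 2 / (r : ℂ) - v) * thetaC ((x : ℂ) ^ (((2 * r : ℝ)) : ℂ)) ((x : ℂ) ^ (2 * v))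

/-- Jacobi theta function with characteristics `a`, `b`. -/
def jTheta (a b : ℝ) (v τ : ℂ) : ℂ :=
  ∑' m : ℤ, Complex.exp ((Real.pi : ℂ) * Complex.I * ((m : ℂ) + (a : ℂ)) *
    (((m : ℂ) + (a : ℂ)) * τ + 2 * (v + (b : ℂ))))

/-- `ε̄_μ = ε_μ - (1/n) Σ_ν ε_ν`, as a vector in `ℝⁿ` (coordinates in the
orthonormal basis `ε_0, …, ε_{n-1}`). -/
def ebar (n : ℕ) (μ : Fin n) : Fin n → ℝ := fun j => (if j = μ then 1 else 0) - 1 / n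

/-- The weight lattice `P = ⊕_μ ℤ ε̄_μ` of `A^{(1)}_{n-1}`, as a subset of `ℝⁿ`. -/
def PLat (n : ℕ) : Set (Fin n → ℝ) :=
  {v | ∃ c : Fin n → ℤ, v = ∑ μ, (c μ : ℝ) • ebar n μ}

/-- The fundamental weight `ω_m = ε̄_0 + ⋯ + ε̄_{m-1}` (with `ω_0 = 0`). -/
def omegaw (n m : ℕ) : Fin n → ℝ :=
  ∑ ν ∈ Finset.univ.filter (fun ν : Fin n => (ν : ℕ) < m), ebar n ν

/-- `ρ = ω_1 + ⋯ + ω_{n-1}`. -/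
def rhoWt (n : ℕ) : Fin n → ℝ := ∑ m ∈ Finset.Icc 1 (n - 1), omegaw n m

/-- `ā_μ = ⟨a + ρ, ε_μ⟩`. -/
def abar (n : ℕ) (a : Fin n → ℝ) (μ : Fin n) : ℝ := a μ + rhoWt n μ

/-- The double infinite product `{z} = (z; x^{2r}, x^{2n})_∞`. -/
def dPoch (x r : ℝ) (n : ℕ) (z : ℂ) : ℂ :=
  ∏' p : ℕ × ℕ, (1 - z * (x : ℂ) ^ (((2 * r * p.1 + 2 * n * p.2 : ℝ)) : ℂ))

/-- `g₁(z) = {x^{2n+2r-2}z}{x²z} / ({x^{2n}z}{x^{2r}z})`. -/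
def gOne (x r : ℝ) (n : ℕ) (z : ℂ) : ℂ :=
  dPoch x r n ((x : ℂ) ^ (((2 * n + 2 * r - 2 : ℝ)) : ℂ) * z) *
      dPoch x r n ((x : ℂ) ^ (2 : ℕ) * z) /
    (dPoch x r n ((x : ℂ) ^ (((2 * (n : ℝ) : ℝ)) : ℂ) * z) *
      dPoch x r n ((x : ℂ) ^ (((2 * r : ℝ)) : ℂ) * z))

/-- `r₁(v) = z^{((r-1)/r)((n-1)/n)} g₁(z⁻¹)/g₁(z)` with `z = x^{2v}`. -/
def rOne (x r : ℝ) (n : ℕ) (v : ℂ) : ℂ :=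
  ((x : ℂ) ^ (2 * v)) ^ (((((r - 1) / r) * (((n : ℝ) - 1) / n) : ℝ)) : ℂ) *
    gOne x r n (((x : ℂ) ^ (2 * v))⁻¹) / gOne x r n ((x : ℂ) ^ (2 * v))

open scoped Classical in
/-- The Boltzmann weight `W[c,d;b,a|v]` of the `A^{(1)}_{n-1}` face model: zero unless
the four pairs `(a,b), (a,d), (b,c), (d,c)` are admissible, and on admissible
configurations given by the three elliptic formulas of the model. -/
def faceW (x r : ℝ) (n : ℕ) (v : ℂ) (c d b a : Fin n → ℝ) : ℂ :=
  if _ : ∃ μ : Fin n, d = a + ebar n μ ∧ b = a + ebar n μ ∧ c = a + ebar n μ + ebar n μ then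
    rOne x r n v
  else if h2 : ∃ p : Fin n × Fin n, p.1 ≠ p.2 ∧ d = a + ebar n p.1 ∧ b = a + ebar n p.2 ∧
      c = a + ebar n p.1 + ebar n p.2 then
    -(rOne x r n v) * ebrk x r v *
        ebrk x r (((abar n a h2.choose.1 - abar n a h2.choose.2 : ℝ) : ℂ) + 1) /
      (ebrk x r (1 - v) * ebrk x r ((abar n a h2.choose.1 - abar n a h2.choose.2 : ℝ) : ℂ))
  else if h3 : ∃ p : Fin n × Fin n, p.1 ≠ p.2 ∧ d = a + ebar n p.1 ∧ b = a + ebar n p.1 ∧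
      c = a + ebar n p.1 + ebar n p.2 then
    rOne x r n v * ebrk x r 1 *
        ebrk x r (v + ((abar n a h3.choose.1 - abar n a h3.choose.2 : ℝ) : ℂ)) /
      (ebrk x r (1 - v) * ebrk x r ((abar n a h3.choose.1 - abar n a h3.choose.2 : ℝ) : ℂ))
  else 0

/-! ### Jacobi triple product -/

def tpP (q : ℝ) (k : ℕ) : ℝ := ∏ j ∈ Finset.range k, (1 - q ^ (j + 1))

def tpR (q : ℝ) (k : ℤ) : ℝ := if k < 0 then 0 else (tpP q k.toNat)⁻¹

lemma tpP_pos {q : ℝ} (h0 : 0 < q) (h1 : q < 1) (k : ℕ) : 0 < tpP q k := by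
  unfold tpP
  apply Finset.prod_pos
  intro j _
  have : q ^ (j + 1) < 1 := pow_lt_one₀ h0.le h1 (by omega)
  linarith

lemma tpR_nat (q : ℝ) (k : ℕ) : tpR q (k : ℤ) = (tpP q k)⁻¹ := by
  unfold tpR
  simp

lemma tpR_step {q : ℝ} (h0 : 0 < q) (h1 : q < 1) (k : ℤ) :
    tpR q (k - 1) = (1 - q ^ k) * tpR q k := by
  rcases lt_trichotomy k 0 with h | h | h
  · have h' : k - 1 < 0 := by omega
    simp [tpR, h, h']
  · subst h
    simp [tpR]
  · obtain ⟨m, rfl⟩ : ∃ m : ℕ, k = (m + 1 : ℕ) := ⟨(k - 1).toNat, by omega⟩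
    have e : ((m + 1 : ℕ) : ℤ) - 1 = (m : ℕ) := by push_cast; ring
    rw [e, tpR_nat, tpR_nat, zpow_natCast]
    have hm := (tpP_pos h0 h1 m).ne'
    have hs : tpP q (m + 1) = tpP q m * (1 - q ^ (m + 1)) := by
      unfold tpP; rw [Finset.prod_range_succ]
    have h2 : (1 - q ^ (m + 1)) ≠ 0 := by
      have : q ^ (m + 1) < 1 := pow_lt_one₀ h0.le h1 (by omega)
      linarith
    rw [hs]
    field_simp

lemma tp_finite {q : ℝ} (h0 : 0 < q) (h1 : q < 1) {z : ℂ} (hz : z ≠ 0) (t : ℤ → ℂ)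
    (t0 : t 0 = 1) (ts : ∀ m, t (m + 1) = - (q : ℂ) ^ m * z * t m) (N : ℕ) :
    HasSum (fun m : ℤ => t m * ((tpP q (2 * N) * tpR q (N + m) * tpR q (N - m) : ℝ) : ℂ))
      (∏ k ∈ Finset.range N, ((1 - z * (q : ℂ) ^ k) * (1 - (q : ℂ) * z⁻¹ * (q : ℂ) ^ k))) := by
  have hq : (q : ℂ) ≠ 0 := by exact_mod_cast h0.ne'
  induction N with
  | zero =>
    have := hasSum_single (f := fun m : ℤ =>
      t m * ((tpP q (2 * 0) * tpR q ((0 : ℕ) + m) * tpR q ((0 : ℕ) - m) : ℝ) : ℂ)) 0 (by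
        intro m hm
        rcases lt_or_gt_of_ne hm with h | h
        · simp [tpR, h]
        · have : -m < 0 := by omega
          simp [tpR, h])
    simpa [t0, tpP, tpR] using this
  | succ N ih =>
    rw [Finset.prod_range_succ]
    set T := ∏ k ∈ Finset.range N, ((1 - z * (q : ℂ) ^ k) * (1 - (q : ℂ) * z⁻¹ * (q : ℂ) ^ k))
    set f := (fun m : ℤ => t m * ((tpP q (2 * N) * tpR q (N + m) * tpR q (N - m) : ℝ) : ℂ)) with hf
    have s1 := ih.mul_left (1 + (q : ℂ) ^ (2 * N + 1))
    have s2 := (((Equiv.addRight (-1 : ℤ)).hasSum_iff).2 ih).mul_left (-(q : ℂ) ^ N * z)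
    have s3 := (((Equiv.addRight (1 : ℤ)).hasSum_iff).2 ih).mul_left (-(q : ℂ) ^ (N + 1) * z⁻¹)
    have s := (s1.add s2).add s3
    have hval : T * ((1 - z * (q : ℂ) ^ N) * (1 - (q : ℂ) * z⁻¹ * (q : ℂ) ^ N)) =
        (1 + (q : ℂ) ^ (2 * N + 1)) * T + -(q : ℂ) ^ N * z * T + -(q : ℂ) ^ (N + 1) * z⁻¹ * T := by
      field_simp
      ring
    rw [hval]
    refine Eq.mp (congrArg (fun g => HasSum g _) ?_) s
    · funext m
      symm
      simp only [Function.comp, Equiv.coe_addRight, hf]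
      have tm : t (m + 1) = - (q : ℂ) ^ m * z * t m := ts m
      have tm' : -(q : ℂ) ^ N * z * t (m + -1) = (q : ℂ) ^ ((N : ℤ) + 1 - m) * t m := by
        have h := ts (m - 1)
        rw [sub_add_cancel] at h
        rw [h, ← sub_eq_add_neg, zpow_sub₀ hq, zpow_sub₀ hq, zpow_add₀ hq]
        have := zpow_ne_zero m hq
        simp only [zpow_natCast, zpow_one]
        field_simp
      have tm'' : -(q : ℂ) ^ (N + 1) * z⁻¹ * t (m + 1) = (q : ℂ) ^ ((N : ℤ) + 1 + m) * t m := by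
        rw [tm, zpow_add₀ hq, zpow_add₀ hq]
        simp only [zpow_natCast, zpow_one]
        field_simp
        ring
      rw [← mul_assoc (-(q : ℂ) ^ N * z), tm', ← mul_assoc (-(q : ℂ) ^ (N + 1) * z⁻¹), tm'']
      have hP : tpP q (2 * (N + 1)) = tpP q (2 * N) * (1 - q ^ (2 * N + 1)) * (1 - q ^ (2 * N + 2)) := by
        unfold tpP
        rw [show 2 * (N + 1) = 2 * N + 1 + 1 by ring, Finset.prod_range_succ, Finset.prod_range_succ]
      have a1 : tpR q (N + m) = (1 - q ^ ((N : ℤ) + 1 + m)) * tpR q (N + 1 + m) := by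
        rw [← tpR_step h0 h1]; congr 1; ring
      have a2 : tpR q (N + (m + -1)) = (1 - q ^ ((N : ℤ) + m)) * tpR q (N + m) := by
        rw [← tpR_step h0 h1]; congr 1; ring
      have b1 : tpR q (N - m) = (1 - q ^ ((N : ℤ) + 1 - m)) * tpR q (N + 1 - m) := by
        rw [← tpR_step h0 h1]; congr 1; ring
      have b2 : tpR q (N - (m + 1)) = (1 - q ^ ((N : ℤ) - m)) * tpR q (N - m) := by
        rw [← tpR_step h0 h1]; congr 1; ring
      have a3 : tpR q (N + (m + 1)) = tpR q (N + 1 + m) := by congr 1; ring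
      have b3 : tpR q (N - (m + -1)) = tpR q (N + 1 - m) := by congr 1; ring
      have c1 : q ^ ((N : ℤ) + m) = q ^ ((N : ℤ) + 1 + m) / q := by
        rw [div_eq_mul_inv, ← zpow_sub_one₀ h0.ne']; congr 1; ring
      have c2 : q ^ ((N : ℤ) - m) = q ^ ((N : ℤ) + 1 - m) / q := by
        rw [div_eq_mul_inv, ← zpow_sub_one₀ h0.ne']; congr 1; ring
      have c3 : q ^ (2 * N + 2) = q ^ ((N : ℤ) + 1 + m) * q ^ ((N : ℤ) + 1 - m) := by
        rw [← zpow_add₀ h0.ne', ← zpow_natCast]; congr 1; push_cast; ring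
      have c4 : q ^ (2 * N + 1) = q ^ ((N : ℤ) + 1 + m) * q ^ ((N : ℤ) + 1 - m) / q := by
        rw [← c3]; field_simp; ring
      have c4' : (q : ℂ) ^ (2 * N + 1) = ((q ^ (2 * N + 1) : ℝ) : ℂ) := by push_cast; rfl
      have c5' : (q : ℂ) ^ ((N : ℤ) + 1 - m) = ((q ^ ((N : ℤ) + 1 - m) : ℝ) : ℂ) := by push_cast; rfl
      have c6' : (q : ℂ) ^ ((N : ℤ) + 1 + m) = ((q ^ ((N : ℤ) + 1 + m) : ℝ) : ℂ) := by push_cast; rfl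
      rw [c4', c5', c6', hP, a3, b3, a2, b2, a1, b1, c1, c2, c3, c4]
      push_cast [Nat.cast_succ]
      generalize ((q : ℂ) ^ ((N : ℤ) + 1 - m)) = β
      generalize ((q : ℂ) ^ ((N : ℤ) + 1 + m)) = α
      field_simp
      ring

lemma tpP_tendsto {q : ℝ} (h0 : 0 < q) (h1 : q < 1) :
    ∃ L : ℝ, 0 < L ∧ Filter.Tendsto (tpP q) Filter.atTop (nhds L) ∧ (∀ k, L ≤ tpP q k) ∧
      qPochC q q = (L : ℂ) := by
  have hs : Summable (fun k : ℕ => ‖-(q ^ (k + 1))‖) := by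
    have : Summable (fun k : ℕ => q ^ k * q) := (summable_geometric_of_lt_one h0.le h1).mul_right q
    refine this.congr fun k => ?_
    rw [norm_neg, Real.norm_of_nonneg (by positivity), pow_succ]
  have hm : Multipliable (fun k : ℕ => 1 + -(q ^ (k + 1))) := multipliable_one_add_of_summable hs
  have ht : Filter.Tendsto (tpP q) Filter.atTop (nhds (∏' k : ℕ, (1 + -(q ^ (k + 1))))) := by
    have := hm.hasProd.tendsto_prod_nat
    refine this.congr fun k => ?_
    simp [tpP, sub_eq_add_neg]
  have hanti : Antitone (tpP q) := by
    apply antitone_nat_of_succ_le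
    intro k
    have e : tpP q (k + 1) = tpP q k * (1 - q ^ (k + 1)) := by
      unfold tpP; rw [Finset.prod_range_succ]
    have := tpP_pos h0 h1 k
    have h2 : 0 < q ^ (k + 1) := by positivity
    rw [e]
    nlinarith
  have hle := fun k => hanti.le_of_tendsto ht k
  refine ⟨_, ?_, ht, hle, ?_⟩
  · refine lt_of_le_of_ne (ge_of_tendsto' ht fun k => (tpP_pos h0 h1 k).le) (Ne.symm ?_)
    apply tprod_one_add_ne_zero_of_summable (f := fun k : ℕ => -(q ^ (k + 1))) _ hs
    intro k
    have : q ^ (k + 1) < 1 := pow_lt_one₀ h0.le h1 (by omega)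
    linarith
  · have := (hm.hasProd.map (Complex.ofRealHom : ℝ →+* ℂ) Complex.continuous_ofReal).tprod_eq
    simp only [Complex.ofRealHom_eq_coe] at this
    rw [← this]
    unfold qPochC
    congr 1
    funext k
    simp
    ring

lemma tpR_nonneg {q : ℝ} (h0 : 0 < q) (h1 : q < 1) (k : ℤ) : 0 ≤ tpR q k := by
  unfold tpR
  split_ifs
  · exact le_rfl
  · exact inv_nonneg.2 (tpP_pos h0 h1 _).le

lemma qPoch_tendsto {q : ℝ} (h0 : 0 < q) (h1 : q < 1) (z : ℂ) :
    Filter.Tendsto (fun N => ∏ k ∈ Finset.range N, (1 - z * (q : ℂ) ^ k)) Filter.atTop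
      (nhds (qPochC z q)) := by
  have hs : Summable (fun k : ℕ => ‖-(z * (q : ℂ) ^ k)‖) := by
    have : Summable (fun k : ℕ => ‖z‖ * q ^ k) := (summable_geometric_of_lt_one h0.le h1).mul_left _
    refine this.congr fun k => ?_
    rw [norm_neg, norm_mul, norm_pow, Complex.norm_real, Real.norm_of_nonneg h0.le]
  have hm := multipliable_one_add_of_summable hs
  have := hm.hasProd.tendsto_prod_nat
  simpa [qPochC, sub_eq_add_neg] using this

theorem tp_main {q : ℝ} (h0 : 0 < q) (h1 : q < 1) {z : ℂ} (hz : z ≠ 0) (t : ℤ → ℂ)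
    (t0 : t 0 = 1) (ts : ∀ m, t (m + 1) = - (q : ℂ) ^ m * z * t m)
    (hsum : Summable fun m => ‖t m‖) : thetaC q z = ∑' m, t m := by
  obtain ⟨L, hL, ht, hle, hP⟩ := tpP_tendsto h0 h1
  have hR : ∀ k, tpR q k ≤ L⁻¹ := by
    intro k
    unfold tpR
    split_ifs
    · positivity
    · exact inv_anti₀ hL (hle _)
  have hP1 : ∀ k, tpP q k ≤ 1 := by
    intro k
    unfold tpP
    apply Finset.prod_le_one
    · intro j _
      have : q ^ (j + 1) < 1 := pow_lt_one₀ h0.le h1 (by omega)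
      linarith
    · intro j _
      have : 0 < q ^ (j + 1) := by positivity
      linarith
  have hlim1 : Filter.Tendsto (fun N => ∏ k ∈ Finset.range N,
      ((1 - z * (q : ℂ) ^ k) * (1 - (q : ℂ) * z⁻¹ * (q : ℂ) ^ k))) Filter.atTop
      (nhds (qPochC z q * qPochC (q * z⁻¹) q)) := by
    simp only [Finset.prod_mul_distrib]
    exact (qPoch_tendsto h0 h1 z).mul (qPoch_tendsto h0 h1 _)
  have hRlim : ∀ g : ℕ → ℤ, Filter.Tendsto g Filter.atTop Filter.atTop →
      Filter.Tendsto (fun N => tpR q (g N)) Filter.atTop (nhds L⁻¹) := by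
    intro g hg
    have hT : Filter.Tendsto (fun N => (g N).toNat) Filter.atTop Filter.atTop := by
      rw [Filter.tendsto_atTop] at hg ⊢
      intro b
      filter_upwards [hg b] with N hN
      omega
    have := (ht.comp hT).inv₀ hL.ne'
    refine this.congr' ?_
    filter_upwards [hg.eventually_ge_atTop 0] with N hN
    simp [tpR, not_lt.2 hN]
  have hlim2 : Filter.Tendsto (fun N : ℕ => ∑' m : ℤ,
      t m * ((tpP q (2 * N) * tpR q (N + m) * tpR q (N - m) : ℝ) : ℂ)) Filter.atTop
      (nhds (∑' m, t m * ((L * L⁻¹ * L⁻¹ : ℝ) : ℂ))) := by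
    apply tendsto_tsum_of_dominated_convergence (bound := fun m => ‖t m‖ * (1 * L⁻¹ * L⁻¹))
      (hsum.mul_right _)
    · intro m
      apply Filter.Tendsto.const_mul
      apply (Complex.continuous_ofReal.tendsto _).comp
      apply Filter.Tendsto.mul
      apply Filter.Tendsto.mul
      · exact ht.comp (Filter.tendsto_id.const_mul_atTop' (by norm_num))
      · apply hRlim
        exact Filter.tendsto_atTop_add_const_right _ _ tendsto_natCast_atTop_atTop
      · apply hRlim
        simp only [sub_eq_add_neg]
        exact Filter.tendsto_atTop_add_const_right _ _ tendsto_natCast_atTop_atTop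
    · refine Filter.Eventually.of_forall fun N m => ?_
      rw [norm_mul, Complex.norm_real]
      have p1 := tpP_pos h0 h1 (2 * N)
      have p2 := tpR_nonneg h0 h1 (N + m)
      have p3 := tpR_nonneg h0 h1 (N - m)
      rw [Real.norm_of_nonneg (by positivity)]
      have := hP1 (2 * N)
      have := hR (N + m)
      have := hR (N - m)
      gcongr
  have heq := tendsto_nhds_unique hlim1 (hlim2.congr fun N => (tp_finite h0 h1 hz t t0 ts N).tsum_eq)
  unfold thetaC
  rw [heq, hP, tsum_mul_right]
  have : (L : ℂ) ≠ 0 := by exact_mod_cast hL.ne'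
  push_cast
  field_simp

/-! ### The bracket as a Gaussian sum and the three-term identity -/

lemma gauss_summable (c ρ : ℝ) (hc : 0 < c) (hρ : 0 < ρ) (w : ℂ) :
    Summable fun m : ℤ => ‖Complex.exp (-(c : ℂ) * (w + ρ * m) ^ 2)‖ := by
  have hpi : (Real.pi : ℂ) ≠ 0 := by exact_mod_cast Real.pi_ne_zero
  have h := ((summable_jacobiTheta₂_term_iff
    (-(2 * c * ρ * w) / (2 * Real.pi * Complex.I)) (((c * ρ ^ 2 / Real.pi : ℝ) : ℂ) * Complex.I)).2 (by
      simp only [Complex.mul_im, Complex.ofReal_re, Complex.I_im, Complex.ofReal_im, Complex.I_re]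
      have := Real.pi_pos
      simp only [mul_one, mul_zero, add_zero]
      positivity)).norm
  refine (h.mul_left ‖Complex.exp (-(c : ℂ) * w ^ 2)‖).congr fun m => ?_
  rw [← norm_mul, jacobiTheta₂_term, ← Complex.exp_add]
  congr 2
  push_cast
  have := Complex.I_sq
  field_simp
  linear_combination (c : ℂ) * ρ ^ 2 * m ^ 2 * this

lemma cpow_exp (ε : ℝ) (w : ℂ) : ((Real.exp (-ε) : ℝ) : ℂ) ^ w = Complex.exp (-ε * w) := by
  rw [Complex.cpow_def_of_ne_zero (by exact_mod_cast (Real.exp_pos _).ne'), ← Complex.ofReal_log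
    (Real.exp_pos _).le, Real.log_exp]
  push_cast
  rfl

def bterm (ε r : ℝ) (v : ℂ) (m : ℤ) : ℂ :=
  (-1) ^ m * Complex.exp (-((ε / r : ℝ) : ℂ) * ((v - r / 2) + r * m) ^ 2)

lemma bterm_summable (ε r : ℝ) (hε : 0 < ε) (hr : 0 < r) (v : ℂ) :
    Summable fun m => ‖bterm ε r v m‖ := by
  refine (gauss_summable (ε / r) r (by positivity) hr (v - r / 2)).congr fun m => ?_
  simp [bterm]

lemma ebrk_eq (ε r : ℝ) (hε : 0 < ε) (hr : 0 < r) (v : ℂ) :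
    ebrk (Real.exp (-ε)) r v = Complex.exp (ε * r / 4) * ∑' m, bterm ε r v m := by
  have hrc : (r : ℂ) ≠ 0 := by exact_mod_cast hr.ne'
  unfold ebrk
  simp only [cpow_exp]
  have hq : Complex.exp (-(ε : ℂ) * ((2 * r : ℝ) : ℂ)) = ((Real.exp (-ε * (2 * r)) : ℝ) : ℂ) := by
    push_cast; rfl
  have key : ∀ m : ℤ, (-1) ^ m * Complex.exp (-(ε : ℂ) * (r * m * (m - 1) + 2 * v * m)) =
      Complex.exp (ε * (v ^ 2 / r - v) + ε * r / 4) * bterm ε r v m := by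
    intro m
    unfold bterm
    rw [mul_left_comm, ← Complex.exp_add]
    congr 2
    push_cast
    field_simp
    ring
  have hth := tp_main (q := Real.exp (-ε * (2 * r))) (Real.exp_pos _)
    (by rw [Real.exp_lt_one_iff]; nlinarith [mul_pos hε hr])
    (z := Complex.exp (-(ε : ℂ) * (2 * v))) (Complex.exp_ne_zero _)
    (fun m : ℤ => (-1) ^ m * Complex.exp (-(ε : ℂ) * (r * m * (m - 1) + 2 * v * m)))
    (by simp) (by
      intro m
      have : ((Real.exp (-ε * (2 * r)) : ℝ) : ℂ) ^ m = Complex.exp (m * (-ε * (2 * r))) := by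
        rw [Complex.exp_int_mul]; push_cast; rfl
      rw [this, zpow_add_one₀ (by norm_num)]
      have : Complex.exp (-(ε : ℂ) * (r * ((m + 1 : ℤ) : ℂ) * (((m + 1 : ℤ) : ℂ) - 1)
          + 2 * v * ((m + 1 : ℤ) : ℂ))) = Complex.exp (m * (-ε * (2 * r))) *
          Complex.exp (-(ε : ℂ) * (2 * v)) *
          Complex.exp (-(ε : ℂ) * (r * m * (m - 1) + 2 * v * m)) := by
        rw [← Complex.exp_add, ← Complex.exp_add]
        congr 1
        push_cast
        ring
      rw [this]
      ring) (by
      refine ((bterm_summable ε r hε hr v).mul_left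
        ‖Complex.exp (ε * (v ^ 2 / r - v) + ε * r / 4)‖).congr fun m => ?_
      rw [← norm_mul, key])
  rw [hq, hth]
  simp only [key]
  rw [tsum_mul_left, ← mul_assoc, ← Complex.exp_add]
  congr 2
  ring

/-- The parity decomposition of pairs of integers. -/
def pairEquiv : (ℤ × ℤ) ⊕ (ℤ × ℤ) ≃ ℤ × ℤ where
  toFun p := match p with
    | Sum.inl (j, k) => (j + k, j - k)
    | Sum.inr (j, k) => (j + k + 1, j - k)
  invFun p := if (p.1 + p.2) % 2 = 0 then Sum.inl ((p.1 + p.2) / 2, (p.1 - p.2) / 2)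
    else Sum.inr ((p.1 + p.2) / 2, (p.1 - p.2) / 2)
  left_inv := by
    rintro (⟨j, k⟩ | ⟨j, k⟩)
    · have : (j + k + (j - k)) % 2 = 0 := by omega
      simp only [this, if_true, Sum.inl.injEq, Prod.mk.injEq]
      omega
    · have : ¬ (j + k + 1 + (j - k)) % 2 = 0 := by omega
      simp only [this, if_false, Sum.inr.injEq, Prod.mk.injEq]
      omega
  right_inv := by
    rintro ⟨m, n⟩
    by_cases h : (m + n) % 2 = 0
    · simp only [h, if_true, Prod.mk.injEq]
      omega
    · simp only [h, if_false, Prod.mk.injEq]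
      omega

def gF (ε r : ℝ) (u : ℂ) (j : ℤ) : ℂ :=
  Complex.exp (-((ε / (2 * r) : ℝ) : ℂ) * (2 * u + (2 * r : ℝ) * j) ^ 2)

def gG (ε r : ℝ) (u : ℂ) (j : ℤ) : ℂ :=
  Complex.exp (-((ε / (2 * r) : ℝ) : ℂ) * ((2 * u - r) + (2 * r : ℝ) * j) ^ 2)

lemma bsum_mul (ε r : ℝ) (hε : 0 < ε) (hr : 0 < r) (u y : ℂ) :
    (∑' m, bterm ε r (u + y) m) * (∑' m, bterm ε r (u - y) m) =
      (∑' j, gG ε r u j) * (∑' j, gF ε r y j) - (∑' j, gF ε r u j) * (∑' j, gG ε r y j) := by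
  have hrc : (r : ℂ) ≠ 0 := by exact_mod_cast hr.ne'
  have sF : ∀ u, Summable fun j => ‖gF ε r u j‖ := fun u =>
    gauss_summable (ε / (2 * r)) (2 * r) (by positivity) (by positivity) (2 * u)
  have sG : ∀ u, Summable fun j => ‖gG ε r u j‖ := fun u =>
    gauss_summable (ε / (2 * r)) (2 * r) (by positivity) (by positivity) (2 * u - r)
  have sB := bterm_summable ε r hε hr
  rw [tsum_mul_tsum_of_summable_norm (sB _) (sB _)]
  have hG : ∑' j, gG ε r y j = ∑' j, gG ε r y (j + 1) :=
    ((Equiv.addRight (1 : ℤ)).tsum_eq (gG ε r y)).symm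
  have sG1 : Summable fun j => ‖gG ε r y (j + 1)‖ :=
    ((Equiv.addRight (1 : ℤ)).summable_iff (f := fun j => ‖gG ε r y j‖)).2 (sG y)
  rw [hG, tsum_mul_tsum_of_summable_norm (sG u) (sF y), tsum_mul_tsum_of_summable_norm (sF u) sG1]
  have h1 := (summable_mul_of_summable_norm (sG u) (sF y)).hasSum
  have h2 := ((summable_mul_of_summable_norm (sF u) sG1).hasSum).neg
  rw [sub_eq_add_neg (tsum _) (tsum _), ← pairEquiv.tsum_eq]
  refine HasSum.tsum_eq ?_
  apply HasSum.sum (M := ℂ)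
  · refine Eq.mp (congrArg (fun g => HasSum g _) ?_) h1
    funext ⟨j, k⟩
    simp only [Function.comp, pairEquiv, Equiv.coe_fn_mk, bterm, gG, gF]
    rw [mul_mul_mul_comm, ← Complex.exp_add, ← Complex.exp_add, ← zpow_add₀ (by norm_num),
      Even.neg_one_zpow ⟨j, by ring⟩, one_mul]
    congr 1
    push_cast
    field_simp
    ring
  · refine Eq.mp (congrArg (fun g => HasSum g _) ?_) h2
    funext ⟨j, k⟩
    simp only [Function.comp, pairEquiv, Equiv.coe_fn_mk, bterm, gG, gF]
    rw [mul_mul_mul_comm, ← Complex.exp_add, ← Complex.exp_add, ← zpow_add₀ (by norm_num),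
      Odd.neg_one_zpow ⟨j, by ring⟩, neg_one_mul]
    congr 2
    push_cast
    field_simp
    ring

theorem ebrk_plucker (ε r : ℝ) (hε : 0 < ε) (hr : 0 < r) : ∃ F G : ℂ → ℂ, ∀ u y,
    ebrk (Real.exp (-ε)) r (u + y) * ebrk (Real.exp (-ε)) r (u - y) = G u * F y - F u * G y := by
  refine ⟨fun u => Complex.exp (ε * r / 4) * ∑' j, gF ε r u j,
    fun u => Complex.exp (ε * r / 4) * ∑' j, gG ε r u j, fun u y => ?_⟩
  rw [ebrk_eq ε r hε hr, ebrk_eq ε r hε hr, mul_mul_mul_comm, bsum_mul ε r hε hr]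
  ring

/-- Weierstrass three-term relation together with oddness. -/
structure IsBracket (h : ℂ → ℂ) : Prop where
  odd : ∀ v, h (-v) = - h v
  three : ∀ s k v w, h (v + s) * h (w + s) * h (v + w + k) * h k
    - h (v + k) * h (w + k) * h (v + w + s) * h s = h v * h w * h (v + w + s + k) * h (k - s)

theorem ebrk_isBracket (ε r : ℝ) (hε : 0 < ε) (hr : 0 < r) (c : ℂ)
    (hc : ebrk (Real.exp (-ε)) r c ≠ 0) : IsBracket (ebrk (Real.exp (-ε)) r) := by
  obtain ⟨F, G, h⟩ := ebrk_plucker ε r hε hr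
  set b := ebrk (Real.exp (-ε)) r with hb
  have hodd : ∀ v, b (-v) = - b v := by
    intro v
    have h1 := h ((c + v) / 2) ((c - v) / 2)
    have h2 := h ((c - v) / 2) ((c + v) / 2)
    rw [show (c + v) / 2 + (c - v) / 2 = c by ring, show (c + v) / 2 - (c - v) / 2 = v by ring] at h1
    rw [show (c - v) / 2 + (c + v) / 2 = c by ring, show (c - v) / 2 - (c + v) / 2 = -v by ring] at h2
    apply mul_left_cancel₀ hc
    linear_combination h1 + h2
  refine ⟨hodd, fun s k v w => ?_⟩
  have e1 := h ((v + w) / 2 + s) ((v - w) / 2)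
  have e2 := h ((v + w) / 2 + k) ((v + w) / 2)
  have e3 := h ((v + w) / 2 + k) ((v - w) / 2)
  have e4 := h ((v + w) / 2 + s) ((v + w) / 2)
  have e5 := h ((v + w) / 2) ((v - w) / 2)
  have e6 := h ((v + w) / 2 + k) ((v + w) / 2 + s)
  rw [show (v + w) / 2 + s + (v - w) / 2 = v + s by ring,
    show (v + w) / 2 + s - (v - w) / 2 = w + s by ring] at e1
  rw [show (v + w) / 2 + k + (v + w) / 2 = v + w + k by ring,
    show (v + w) / 2 + k - (v + w) / 2 = k by ring] at e2
  rw [show (v + w) / 2 + k + (v - w) / 2 = v + k by ring,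
    show (v + w) / 2 + k - (v - w) / 2 = w + k by ring] at e3
  rw [show (v + w) / 2 + s + (v + w) / 2 = v + w + s by ring,
    show (v + w) / 2 + s - (v + w) / 2 = s by ring] at e4
  rw [show (v + w) / 2 + (v - w) / 2 = v by ring,
    show (v + w) / 2 - (v - w) / 2 = w by ring] at e5
  rw [show (v + w) / 2 + k + ((v + w) / 2 + s) = v + w + s + k by ring,
    show (v + w) / 2 + k - ((v + w) / 2 + s) = k - s by ring] at e6
  rw [mul_assoc, mul_assoc (b (v + k) * _), mul_assoc (b v * _), e1, e2, e3, e4, e5, e6]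
  ring

lemma IsBracket.ng {h : ℂ → ℂ} (hb : IsBracket h) {x y : ℂ} (e : x = -y) : h x = -h y := by
  rw [e, hb.odd]
/-! ### Theta function identities -/

/-- Normalised weight of the second kind. -/
def n2 (h : ℂ → ℂ) (v A : ℂ) : ℂ := -(h v * h (A + 1)) / (h (1 - v) * h A)

/-- Normalised weight of the third kind. -/
def n3 (h : ℂ → ℂ) (v A : ℂ) : ℂ := h 1 * h (v + A) / (h (1 - v) * h A)

lemma ybe_123_123 {h : ℂ → ℂ} (hb : IsBracket h) (s t v w : ℂ)
    (hd0 : h (v + w - 1) ≠ 0) (hd1 : h (v - 1) ≠ 0) (hd2 : h (w - 1) ≠ 0) (hz0 : h (s + t) ≠ 0) (hz1 : h (s) ≠ 0) (hz2 : h (t) ≠ 0) :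
    n3 h (v + w) t * n3 h v s * n3 h w s + n3 h (v + w) (s + t) * n2 h v (-s) * n2 h w s =
      n3 h (v + w) s * n3 h v t * n3 h w t + n3 h (v + w) (s + t) * n2 h v t * n2 h w (-t) := by
  have e0 : h (1 - (v + w)) = -h (v + w - 1) := hb.ng (by ring)
  have e1 : h (1 - v) = -h (v - 1) := hb.ng (by ring)
  have e2 : h (1 - w) = -h (w - 1) := hb.ng (by ring)
  have e3 : h (v + w + (s + t)) = h (v + w + s + t) := congrArg h (by ring)
  have e4 : h (-s) = -h (s) := hb.ng (by ring)
  have e5 : h (-s + 1) = -h (s - 1) := hb.ng (by ring)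
  have e6 : h (-t) = -h (t) := hb.ng (by ring)
  have e7 : h (-t + 1) = -h (t - 1) := hb.ng (by ring)
  have k1 : (1) * h (v + s) * h (w + s) * h (v + w + t) * h (t) + (-1) * h (v + t) * h (w + t) * h (v + w + s) * h (s) + (1) * h (v) * h (w) * h (v + w + s + t) * h (s - t) = 0 := by
    have := hb.three s t v w
    have k1e0 : h (t - s) = -h (s - t) := hb.ng (by ring)
    simp only [k1e0] at this
    linear_combination this
  have k2 : (1) * h (s + 1) * h (s - 1) * h (t) * h (t) + (-1) * h (t + 1) * h (t - 1) * h (s) * h (s) + (-1) * h (1) * h (1) * h (s + t) * h (s - t) = 0 := by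
    have := hb.three s t 1 (-1)
    have k2e0 : h (1 + s) = h (s + 1) := congrArg h (by ring)
    have k2e1 : h (-1 + s) = h (s - 1) := congrArg h (by ring)
    have k2e2 : h (1 + (-1) + t) = h (t) := congrArg h (by ring)
    have k2e3 : h (1 + t) = h (t + 1) := congrArg h (by ring)
    have k2e4 : h (-1 + t) = h (t - 1) := congrArg h (by ring)
    have k2e5 : h (1 + (-1) + s) = h (s) := congrArg h (by ring)
    have k2e6 : h (-1) = -h (1) := hb.ng (by ring)
    have k2e7 : h (1 + (-1) + s + t) = h (s + t) := congrArg h (by ring)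
    have k2e8 : h (t - s) = -h (s - t) := hb.ng (by ring)
    simp only [k2e0, k2e1, k2e2, k2e3, k2e4, k2e5, k2e6, k2e7, k2e8] at this
    linear_combination this
  simp only [n2, n3, e0, e1, e2, e3, e4, e5, e6, e7]
  linear_combination (norm := skip) (-1) / h (t) / h (t) * h (1) * h (1) * h (1) / h (s) / h (s) / h (v + w - 1) / h (v - 1) / h (w - 1) * k1
    + (-1) * h (v + w + s + t) / h (s) / h (s) / h (s + t) * h (1) * h (w) / h (t) / h (t) * h (v) / h (v + w - 1) / h (v - 1) / h (w - 1) * k2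
  field_simp
  try ring

lemma ybe_123_132 {h : ℂ → ℂ} (hb : IsBracket h) (s t v w : ℂ)
    (hd0 : h (v + w - 1) ≠ 0) (hd1 : h (v - 1) ≠ 0) (hd2 : h (w - 1) ≠ 0) (hz0 : h (s + t) ≠ 0) (hz1 : h (s) ≠ 0) (hz2 : h (t) ≠ 0) :
    n2 h (v + w) (-t) * n3 h v s * n3 h w (s + t) + 0 =
      n3 h (v + w) s * n2 h v (-t) * n3 h w t + n3 h (v + w) (s + t) * n3 h v (-t) * n2 h w (-t) := by
  have e0 : h (1 - (v + w)) = -h (v + w - 1) := hb.ng (by ring)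
  have e1 : h (-t) = -h (t) := hb.ng (by ring)
  have e2 : h (-t + 1) = -h (t - 1) := hb.ng (by ring)
  have e3 : h (1 - v) = -h (v - 1) := hb.ng (by ring)
  have e4 : h (1 - w) = -h (w - 1) := hb.ng (by ring)
  have e5 : h (w + (s + t)) = h (w + s + t) := congrArg h (by ring)
  have e6 : h (v + w + (s + t)) = h (v + w + s + t) := congrArg h (by ring)
  have e7 : h (v + (-t)) = h (v - t) := congrArg h (by ring)
  have k1 : (1) * h (v + w) * h (v + s) * h (t) * h (w + s + t) + (-1) * h (w + t) * h (s + t) * h (v) * h (v + w + s) + (1) * h (s) * h (w) * h (v + w + s + t) * h (v - t) = 0 := by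
    have := hb.three (v + w + s) (w + s + t) (-s) (-w)
    have k1e0 : h (-s + (v + w + s)) = h (v + w) := congrArg h (by ring)
    have k1e1 : h (-w + (v + w + s)) = h (v + s) := congrArg h (by ring)
    have k1e2 : h (-s + (-w) + (w + s + t)) = h (t) := congrArg h (by ring)
    have k1e3 : h (-s + (w + s + t)) = h (w + t) := congrArg h (by ring)
    have k1e4 : h (-w + (w + s + t)) = h (s + t) := congrArg h (by ring)
    have k1e5 : h (-s + (-w) + (v + w + s)) = h (v) := congrArg h (by ring)
    have k1e6 : h (-s) = -h (s) := hb.ng (by ring)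
    have k1e7 : h (-w) = -h (w) := hb.ng (by ring)
    have k1e8 : h (-s + (-w) + (v + w + s) + (w + s + t)) = h (v + w + s + t) := congrArg h (by ring)
    have k1e9 : h (w + s + t - (v + w + s)) = -h (v - t) := hb.ng (by ring)
    simp only [k1e0, k1e1, k1e2, k1e3, k1e4, k1e5, k1e6, k1e7, k1e8, k1e9] at this
    linear_combination this
  simp only [n2, n3, e0, e1, e2, e3, e4, e5, e6, e7]
  linear_combination (norm := skip) (1) / h (s) * h (t - 1) / h (s + t) * h (1) * h (1) / h (t) / h (t) / h (v + w - 1) / h (v - 1) / h (w - 1) * k1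
  field_simp
  try ring

lemma ybe_123_213 {h : ℂ → ℂ} (hb : IsBracket h) (s t v w : ℂ)
    (hd0 : h (v + w - 1) ≠ 0) (hd1 : h (v - 1) ≠ 0) (hd2 : h (w - 1) ≠ 0) (hz0 : h (s + t) ≠ 0) (hz1 : h (s) ≠ 0) (hz2 : h (t) ≠ 0) :
    n3 h (v + w) t * n3 h v s * n2 h w (-s) + n3 h (v + w) (s + t) * n2 h v (-s) * n3 h w (-s) =
      n2 h (v + w) (-s) * n3 h v (s + t) * n3 h w t + 0 := by
  have e0 : h (1 - (v + w)) = -h (v + w - 1) := hb.ng (by ring)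
  have e1 : h (1 - v) = -h (v - 1) := hb.ng (by ring)
  have e2 : h (1 - w) = -h (w - 1) := hb.ng (by ring)
  have e3 : h (-s) = -h (s) := hb.ng (by ring)
  have e4 : h (-s + 1) = -h (s - 1) := hb.ng (by ring)
  have e5 : h (v + w + (s + t)) = h (v + w + s + t) := congrArg h (by ring)
  have e6 : h (w + (-s)) = h (w - s) := congrArg h (by ring)
  have e7 : h (v + (s + t)) = h (v + s + t) := congrArg h (by ring)
  have k1 : (1) * h (v + w + t) * h (v + s) * h (w) * h (s + t) + (-1) * h (w + t) * h (s) * h (v + w) * h (v + s + t) + (-1) * h (w - s) * h (t) * h (v + w + s + t) * h (v) = 0 := by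
    have := hb.three (v + s + t) (s + t) (w - s) (-t)
    have k1e0 : h (w - s + (v + s + t)) = h (v + w + t) := congrArg h (by ring)
    have k1e1 : h (-t + (v + s + t)) = h (v + s) := congrArg h (by ring)
    have k1e2 : h (w - s + (-t) + (s + t)) = h (w) := congrArg h (by ring)
    have k1e3 : h (w - s + (s + t)) = h (w + t) := congrArg h (by ring)
    have k1e4 : h (-t + (s + t)) = h (s) := congrArg h (by ring)
    have k1e5 : h (w - s + (-t) + (v + s + t)) = h (v + w) := congrArg h (by ring)
    have k1e6 : h (-t) = -h (t) := hb.ng (by ring)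
    have k1e7 : h (w - s + (-t) + (v + s + t) + (s + t)) = h (v + w + s + t) := congrArg h (by ring)
    have k1e8 : h (s + t - (v + s + t)) = -h (v) := hb.ng (by ring)
    simp only [k1e0, k1e1, k1e2, k1e3, k1e4, k1e5, k1e6, k1e7, k1e8] at this
    linear_combination this
  simp only [n2, n3, e0, e1, e2, e3, e4, e5, e6, e7]
  linear_combination (norm := skip) (1) / h (s) / h (s) / h (s + t) * h (1) * h (1) / h (t) * h (s - 1) / h (v + w - 1) / h (v - 1) / h (w - 1) * k1
  field_simp
  try ring

lemma ybe_123_231 {h : ℂ → ℂ} (hb : IsBracket h) (s t v w : ℂ)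
    (hd0 : h (v + w - 1) ≠ 0) (hd1 : h (v - 1) ≠ 0) (hd2 : h (w - 1) ≠ 0) (hz0 : h (s + t) ≠ 0) (hz1 : h (s) ≠ 0) (hz2 : h (t) ≠ 0) :
    0 + n2 h (v + w) (-s - t) * n2 h v (-s) * n3 h w t =
      n2 h (v + w) (-s) * n2 h v (-s - t) * n3 h w t + 0 := by
  have e0 : h (1 - (v + w)) = -h (v + w - 1) := hb.ng (by ring)
  have e1 : h (-s - t) = -h (s + t) := hb.ng (by ring)
  have e2 : h (-s - t + 1) = -h (s + t - 1) := hb.ng (by ring)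
  have e3 : h (1 - v) = -h (v - 1) := hb.ng (by ring)
  have e4 : h (-s) = -h (s) := hb.ng (by ring)
  have e5 : h (-s + 1) = -h (s - 1) := hb.ng (by ring)
  have e6 : h (1 - w) = -h (w - 1) := hb.ng (by ring)
  simp only [n2, n3, e0, e1, e2, e3, e4, e5, e6]
  field_simp
  try ring

lemma ybe_123_312 {h : ℂ → ℂ} (hb : IsBracket h) (s t v w : ℂ)
    (hd0 : h (v + w - 1) ≠ 0) (hd1 : h (v - 1) ≠ 0) (hd2 : h (w - 1) ≠ 0) (hz0 : h (s + t) ≠ 0) (hz1 : h (s) ≠ 0) (hz2 : h (t) ≠ 0) :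
    n2 h (v + w) (-t) * n3 h v s * n2 h w (-s - t) + 0 =
      0 + n2 h (v + w) (-s - t) * n3 h v s * n2 h w (-t) := by
  have e0 : h (1 - (v + w)) = -h (v + w - 1) := hb.ng (by ring)
  have e1 : h (-t) = -h (t) := hb.ng (by ring)
  have e2 : h (-t + 1) = -h (t - 1) := hb.ng (by ring)
  have e3 : h (1 - v) = -h (v - 1) := hb.ng (by ring)
  have e4 : h (1 - w) = -h (w - 1) := hb.ng (by ring)
  have e5 : h (-s - t) = -h (s + t) := hb.ng (by ring)
  have e6 : h (-s - t + 1) = -h (s + t - 1) := hb.ng (by ring)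
  simp only [n2, n3, e0, e1, e2, e3, e4, e5, e6]
  field_simp
  try ring

lemma ybe_123_321 {h : ℂ → ℂ} (_hb : IsBracket h) (s t v w : ℂ)
    (_hd0 : h (v + w - 1) ≠ 0) (_hd1 : h (v - 1) ≠ 0) (_hd2 : h (w - 1) ≠ 0) (_hz0 : h (s + t) ≠ 0) (_hz1 : h (s) ≠ 0) (_hz2 : h (t) ≠ 0) :
    0 + n2 h (v + w) (-s - t) * n2 h v (-s) * n2 h w (-t) =
      0 + n2 h (v + w) (-s - t) * n2 h v (-s) * n2 h w (-t) := by
  rfl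

lemma ybe_112_112 {h : ℂ → ℂ} (hb : IsBracket h) (s v w : ℂ)
    (hd0 : h (v + w - 1) ≠ 0) (hd1 : h (v - 1) ≠ 0) (hd2 : h (w - 1) ≠ 0) (hz0 : h (s + 1) ≠ 0) (hz1 : h (s) ≠ 0) :
    n3 h (v + w) (s + 1) * 1 * 1 =
      1 * n3 h v (s + 1) * n3 h w (s + 1) + n3 h (v + w) s * n2 h v (s + 1) * n2 h w (-s - 1) := by
  have e0 : h (1 - (v + w)) = -h (v + w - 1) := hb.ng (by ring)
  have e1 : h (v + w + (s + 1)) = h (v + w + s + 1) := congrArg h (by ring)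
  have e2 : h (1 - v) = -h (v - 1) := hb.ng (by ring)
  have e3 : h (v + (s + 1)) = h (v + s + 1) := congrArg h (by ring)
  have e4 : h (1 - w) = -h (w - 1) := hb.ng (by ring)
  have e5 : h (w + (s + 1)) = h (w + s + 1) := congrArg h (by ring)
  have e6 : h (s + 1 + 1) = h (s + 2) := congrArg h (by ring)
  have e7 : h (-s - 1) = -h (s + 1) := hb.ng (by ring)
  have e8 : h (-s - 1 + 1) = -h (s) := hb.ng (by ring)
  have k1 : (1) * h (v - 1) * h (w - 1) * h (v + w + s + 1) * h (s + 1) + (1) * h (v + s + 1) * h (w + s + 1) * h (v + w - 1) * h (1) + (-1) * h (v) * h (w) * h (v + w + s) * h (s + 2) = 0 := by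
    have := hb.three (-1) (s + 1) v w
    have k1e0 : h (v + (-1)) = h (v - 1) := congrArg h (by ring)
    have k1e1 : h (w + (-1)) = h (w - 1) := congrArg h (by ring)
    have k1e2 : h (v + w + (s + 1)) = h (v + w + s + 1) := congrArg h (by ring)
    have k1e3 : h (v + (s + 1)) = h (v + s + 1) := congrArg h (by ring)
    have k1e4 : h (w + (s + 1)) = h (w + s + 1) := congrArg h (by ring)
    have k1e5 : h (v + w + (-1)) = h (v + w - 1) := congrArg h (by ring)
    have k1e6 : h (-1) = -h (1) := hb.ng (by ring)
    have k1e7 : h (v + w + (-1) + (s + 1)) = h (v + w + s) := congrArg h (by ring)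
    have k1e8 : h (s + 1 - (-1)) = h (s + 2) := congrArg h (by ring)
    simp only [k1e0, k1e1, k1e2, k1e3, k1e4, k1e5, k1e6, k1e7, k1e8] at this
    linear_combination this
  simp only [n2, n3, e0, e1, e2, e3, e4, e5, e6, e7, e8]
  linear_combination (norm := skip) (-1) / h (s + 1) / h (s + 1) * h (1) / h (v + w - 1) / h (v - 1) / h (w - 1) * k1
  field_simp
  try ring

lemma ybe_112_121 {h : ℂ → ℂ} (hb : IsBracket h) (s v w : ℂ)
    (hd0 : h (v + w - 1) ≠ 0) (hd1 : h (v - 1) ≠ 0) (hd2 : h (w - 1) ≠ 0) (hz0 : h (s + 1) ≠ 0) (hz1 : h (s) ≠ 0) :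
    n2 h (v + w) (-s - 1) * 1 * n3 h w s =
      1 * n2 h v (-s - 1) * n3 h w (s + 1) + n3 h (v + w) s * n3 h v (-s - 1) * n2 h w (-s - 1) := by
  have e0 : h (1 - (v + w)) = -h (v + w - 1) := hb.ng (by ring)
  have e1 : h (-s - 1) = -h (s + 1) := hb.ng (by ring)
  have e2 : h (-s - 1 + 1) = -h (s) := hb.ng (by ring)
  have e3 : h (1 - w) = -h (w - 1) := hb.ng (by ring)
  have e4 : h (1 - v) = -h (v - 1) := hb.ng (by ring)
  have e5 : h (w + (s + 1)) = h (w + s + 1) := congrArg h (by ring)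
  have e6 : h (v + (-s - 1)) = h (v - s - 1) := congrArg h (by ring)
  have k1 : (1) * h (v - 1) * h (v + w) * h (w + s) * h (s + 1) + (-1) * h (s) * h (w + s + 1) * h (v + w - 1) * h (v) + (-1) * h (1) * h (w) * h (v + w + s) * h (v - s - 1) = 0 := by
    have := hb.three v (s + 1) (-1) w
    have k1e0 : h (-1 + v) = h (v - 1) := congrArg h (by ring)
    have k1e1 : h (w + v) = h (v + w) := congrArg h (by ring)
    have k1e2 : h (-1 + w + (s + 1)) = h (w + s) := congrArg h (by ring)
    have k1e3 : h (-1 + (s + 1)) = h (s) := congrArg h (by ring)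
    have k1e4 : h (w + (s + 1)) = h (w + s + 1) := congrArg h (by ring)
    have k1e5 : h (-1 + w + v) = h (v + w - 1) := congrArg h (by ring)
    have k1e6 : h (-1) = -h (1) := hb.ng (by ring)
    have k1e7 : h (-1 + w + v + (s + 1)) = h (v + w + s) := congrArg h (by ring)
    have k1e8 : h (s + 1 - v) = -h (v - s - 1) := hb.ng (by ring)
    simp only [k1e0, k1e1, k1e2, k1e3, k1e4, k1e5, k1e6, k1e7, k1e8] at this
    linear_combination this
  simp only [n2, n3, e0, e1, e2, e3, e4, e5, e6]
  linear_combination (norm := skip) (-1) / h (s + 1) / h (s + 1) * h (1) / h (v + w - 1) / h (v - 1) / h (w - 1) * k1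
  field_simp
  try ring

lemma ybe_112_211 {h : ℂ → ℂ} (hb : IsBracket h) (s v w : ℂ)
    (hd0 : h (v + w - 1) ≠ 0) (hd1 : h (v - 1) ≠ 0) (hd2 : h (w - 1) ≠ 0) (hz0 : h (s + 1) ≠ 0) (hz1 : h (s) ≠ 0) :
    n2 h (v + w) (-s - 1) * 1 * n2 h w (-s) =
      0 + n2 h (v + w) (-s) * 1 * n2 h w (-s - 1) := by
  have e0 : h (1 - (v + w)) = -h (v + w - 1) := hb.ng (by ring)
  have e1 : h (-s - 1) = -h (s + 1) := hb.ng (by ring)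
  have e2 : h (-s - 1 + 1) = -h (s) := hb.ng (by ring)
  have e3 : h (1 - w) = -h (w - 1) := hb.ng (by ring)
  have e4 : h (-s) = -h (s) := hb.ng (by ring)
  have e5 : h (-s + 1) = -h (s - 1) := hb.ng (by ring)
  simp only [n2, n3, e0, e1, e2, e3, e4, e5]
  field_simp
  try ring

lemma ybe_121_112 {h : ℂ → ℂ} (hb : IsBracket h) (s v w : ℂ)
    (hd0 : h (v + w - 1) ≠ 0) (hd1 : h (v - 1) ≠ 0) (hd2 : h (w - 1) ≠ 0) (hz0 : h (s + 1) ≠ 0) (hz1 : h (s) ≠ 0) :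
    n2 h (v + w) (s + 1) * n3 h v s * 1 + 0 =
      n3 h (v + w) s * n2 h v (s + 1) * n3 h w (-s - 1) + 1 * n3 h v (s + 1) * n2 h w (s + 1) := by
  have e0 : h (1 - (v + w)) = -h (v + w - 1) := hb.ng (by ring)
  have e1 : h (s + 1 + 1) = h (s + 2) := congrArg h (by ring)
  have e2 : h (1 - v) = -h (v - 1) := hb.ng (by ring)
  have e3 : h (1 - w) = -h (w - 1) := hb.ng (by ring)
  have e4 : h (-s - 1) = -h (s + 1) := hb.ng (by ring)
  have e5 : h (w + (-s - 1)) = h (w - s - 1) := congrArg h (by ring)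
  have e6 : h (v + (s + 1)) = h (v + s + 1) := congrArg h (by ring)
  have k1 : (1) * h (v + w) * h (v + s) * h (w - 1) * h (s + 1) + (-1) * h (w) * h (s) * h (v + w - 1) * h (v + s + 1) + (-1) * h (w - s - 1) * h (1) * h (v + w + s) * h (v) = 0 := by
    have := hb.three (v + s + 1) (s + 1) (w - s - 1) (-1)
    have k1e0 : h (w - s - 1 + (v + s + 1)) = h (v + w) := congrArg h (by ring)
    have k1e1 : h (-1 + (v + s + 1)) = h (v + s) := congrArg h (by ring)
    have k1e2 : h (w - s - 1 + (-1) + (s + 1)) = h (w - 1) := congrArg h (by ring)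
    have k1e3 : h (w - s - 1 + (s + 1)) = h (w) := congrArg h (by ring)
    have k1e4 : h (-1 + (s + 1)) = h (s) := congrArg h (by ring)
    have k1e5 : h (w - s - 1 + (-1) + (v + s + 1)) = h (v + w - 1) := congrArg h (by ring)
    have k1e6 : h (-1) = -h (1) := hb.ng (by ring)
    have k1e7 : h (w - s - 1 + (-1) + (v + s + 1) + (s + 1)) = h (v + w + s) := congrArg h (by ring)
    have k1e8 : h (s + 1 - (v + s + 1)) = -h (v) := hb.ng (by ring)
    simp only [k1e0, k1e1, k1e2, k1e3, k1e4, k1e5, k1e6, k1e7, k1e8] at this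
    linear_combination this
  simp only [n2, n3, e0, e1, e2, e3, e4, e5, e6]
  linear_combination (norm := skip) (-1) / h (s + 1) / h (s + 1) / h (s) * h (1) * h (s + 2) / h (v + w - 1) / h (v - 1) / h (w - 1) * k1
  field_simp
  try ring

lemma ybe_121_121 {h : ℂ → ℂ} (hb : IsBracket h) (s v w : ℂ)
    (hd0 : h (v + w - 1) ≠ 0) (hd1 : h (v - 1) ≠ 0) (hd2 : h (w - 1) ≠ 0) (hz0 : h (s + 1) ≠ 0) (hz1 : h (s) ≠ 0) :
    n3 h (v + w) (-s - 1) * n3 h v s * n3 h w s + 1 * n2 h v (-s) * n2 h w s =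
      n3 h (v + w) s * n3 h v (-s - 1) * n3 h w (-s - 1) + 1 * n2 h v (-s - 1) * n2 h w (s + 1) := by
  have e0 : h (1 - (v + w)) = -h (v + w - 1) := hb.ng (by ring)
  have e1 : h (-s - 1) = -h (s + 1) := hb.ng (by ring)
  have e2 : h (v + w + (-s - 1)) = h (v + w - s - 1) := congrArg h (by ring)
  have e3 : h (1 - v) = -h (v - 1) := hb.ng (by ring)
  have e4 : h (1 - w) = -h (w - 1) := hb.ng (by ring)
  have e5 : h (-s) = -h (s) := hb.ng (by ring)
  have e6 : h (-s + 1) = -h (s - 1) := hb.ng (by ring)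
  have e7 : h (v + (-s - 1)) = h (v - s - 1) := congrArg h (by ring)
  have e8 : h (w + (-s - 1)) = h (w - s - 1) := congrArg h (by ring)
  have e9 : h (-s - 1 + 1) = -h (s) := hb.ng (by ring)
  have e10 : h (s + 1 + 1) = h (s + 2) := congrArg h (by ring)
  have k1 : (-1) * h (v + s) * h (w + s) * h (v + w - s - 1) * h (s + 1) + (-1) * h (v - s - 1) * h (w - s - 1) * h (v + w + s) * h (s) + (1) * h (v) * h (w) * h (v + w - 1) * h (2 * s + 1) = 0 := by
    have := hb.three s (-s - 1) v w
    have k1e0 : h (v + w + (-s - 1)) = h (v + w - s - 1) := congrArg h (by ring)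
    have k1e1 : h (-s - 1) = -h (s + 1) := hb.ng (by ring)
    have k1e2 : h (v + (-s - 1)) = h (v - s - 1) := congrArg h (by ring)
    have k1e3 : h (w + (-s - 1)) = h (w - s - 1) := congrArg h (by ring)
    have k1e4 : h (v + w + s + (-s - 1)) = h (v + w - 1) := congrArg h (by ring)
    have k1e5 : h (-s - 1 - s) = -h (2 * s + 1) := hb.ng (by ring)
    simp only [k1e0, k1e1, k1e2, k1e3, k1e4, k1e5] at this
    linear_combination this
  have k2 : (1) * h (s + 1) * h (s + 1) * h (s + 1) * h (s - 1) + (-1) * h (s) * h (s) * h (s) * h (s + 2) + (1) * h (1) * h (1) * h (1) * h (2 * s + 1) = 0 := by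
    have := hb.three s (s - 1) 1 1
    have k2e0 : h (1 + s) = h (s + 1) := congrArg h (by ring)
    have k2e1 : h (1 + 1 + (s - 1)) = h (s + 1) := congrArg h (by ring)
    have k2e2 : h (1 + (s - 1)) = h (s) := congrArg h (by ring)
    have k2e3 : h (1 + 1 + s) = h (s + 2) := congrArg h (by ring)
    have k2e4 : h (1 + 1 + s + (s - 1)) = h (2 * s + 1) := congrArg h (by ring)
    have k2e5 : h (s - 1 - s) = -h (1) := hb.ng (by ring)
    simp only [k2e0, k2e1, k2e2, k2e3, k2e4, k2e5] at this
    linear_combination this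
  simp only [n2, n3, e0, e1, e2, e3, e4, e5, e6, e7, e8, e9, e10]
  linear_combination (norm := skip) (-1) * h (1) * h (1) * h (1) / h (s + 1) / h (s + 1) / h (s) / h (s) / h (v + w - 1) / h (v - 1) / h (w - 1) * k1
    + (1) / h (s + 1) / h (s + 1) / h (s) / h (s) * h (w) * h (v) / h (v - 1) / h (w - 1) * k2
  field_simp
  try ring

lemma ybe_121_211 {h : ℂ → ℂ} (hb : IsBracket h) (s v w : ℂ)
    (hd0 : h (v + w - 1) ≠ 0) (hd1 : h (v - 1) ≠ 0) (hd2 : h (w - 1) ≠ 0) (hz0 : h (s + 1) ≠ 0) (hz1 : h (s) ≠ 0) :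
    n3 h (v + w) (-s - 1) * n3 h v s * n2 h w (-s) + 1 * n2 h v (-s) * n3 h w (-s) =
      n2 h (v + w) (-s) * 1 * n3 h w (-s - 1) + 0 := by
  have e0 : h (1 - (v + w)) = -h (v + w - 1) := hb.ng (by ring)
  have e1 : h (-s - 1) = -h (s + 1) := hb.ng (by ring)
  have e2 : h (v + w + (-s - 1)) = h (v + w - s - 1) := congrArg h (by ring)
  have e3 : h (1 - v) = -h (v - 1) := hb.ng (by ring)
  have e4 : h (1 - w) = -h (w - 1) := hb.ng (by ring)
  have e5 : h (-s) = -h (s) := hb.ng (by ring)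
  have e6 : h (-s + 1) = -h (s - 1) := hb.ng (by ring)
  have e7 : h (w + (-s)) = h (w - s) := congrArg h (by ring)
  have e8 : h (w + (-s - 1)) = h (w - s - 1) := congrArg h (by ring)
  have k1 : (1) * h (v + w - s - 1) * h (v + s) * h (1) * h (w) + (-1) * h (w - s) * h (s + 1) * h (v) * h (v + w - 1) + (1) * h (s) * h (w - s - 1) * h (v + w) * h (v - 1) = 0 := by
    have := hb.three (v + w - 1) w (-s) (-w + s + 1)
    have k1e0 : h (-s + (v + w - 1)) = h (v + w - s - 1) := congrArg h (by ring)
    have k1e1 : h (-w + s + 1 + (v + w - 1)) = h (v + s) := congrArg h (by ring)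
    have k1e2 : h (-s + (-w + s + 1) + w) = h (1) := congrArg h (by ring)
    have k1e3 : h (-s + w) = h (w - s) := congrArg h (by ring)
    have k1e4 : h (-w + s + 1 + w) = h (s + 1) := congrArg h (by ring)
    have k1e5 : h (-s + (-w + s + 1) + (v + w - 1)) = h (v) := congrArg h (by ring)
    have k1e6 : h (-s) = -h (s) := hb.ng (by ring)
    have k1e7 : h (-w + s + 1) = -h (w - s - 1) := hb.ng (by ring)
    have k1e8 : h (-s + (-w + s + 1) + (v + w - 1) + w) = h (v + w) := congrArg h (by ring)
    have k1e9 : h (w - (v + w - 1)) = -h (v - 1) := hb.ng (by ring)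
    simp only [k1e0, k1e1, k1e2, k1e3, k1e4, k1e5, k1e6, k1e7, k1e8, k1e9] at this
    linear_combination this
  simp only [n2, n3, e0, e1, e2, e3, e4, e5, e6, e7, e8]
  linear_combination (norm := skip) (-1) / h (s + 1) / h (s) / h (s) * h (1) * h (s - 1) / h (v + w - 1) / h (v - 1) / h (w - 1) * k1
  field_simp
  try ring

lemma ybe_211_112 {h : ℂ → ℂ} (hb : IsBracket h) (s v w : ℂ)
    (hd0 : h (v + w - 1) ≠ 0) (hd1 : h (v - 1) ≠ 0) (hd2 : h (w - 1) ≠ 0) (hz0 : h (s + 1) ≠ 0) (hz1 : h (s) ≠ 0) :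
    0 + n2 h (v + w) (s + 1) * n2 h v s * 1 =
      n2 h (v + w) s * n2 h v (s + 1) * 1 := by
  have e0 : h (1 - (v + w)) = -h (v + w - 1) := hb.ng (by ring)
  have e1 : h (s + 1 + 1) = h (s + 2) := congrArg h (by ring)
  have e2 : h (1 - v) = -h (v - 1) := hb.ng (by ring)
  simp only [n2, n3, e0, e1, e2]
  field_simp
  try ring

lemma ybe_211_121 {h : ℂ → ℂ} (hb : IsBracket h) (s v w : ℂ)
    (hd0 : h (v + w - 1) ≠ 0) (hd1 : h (v - 1) ≠ 0) (hd2 : h (w - 1) ≠ 0) (hz0 : h (s + 1) ≠ 0) (hz1 : h (s) ≠ 0) :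
    1 * n3 h v (-s) * n2 h w s + n3 h (v + w) (-s - 1) * n2 h v s * n3 h w s =
      n2 h (v + w) s * n3 h v (-s - 1) * 1 := by
  have e0 : h (1 - v) = -h (v - 1) := hb.ng (by ring)
  have e1 : h (-s) = -h (s) := hb.ng (by ring)
  have e2 : h (v + (-s)) = h (v - s) := congrArg h (by ring)
  have e3 : h (1 - w) = -h (w - 1) := hb.ng (by ring)
  have e4 : h (1 - (v + w)) = -h (v + w - 1) := hb.ng (by ring)
  have e5 : h (-s - 1) = -h (s + 1) := hb.ng (by ring)
  have e6 : h (v + w + (-s - 1)) = h (v + w - s - 1) := congrArg h (by ring)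
  have e7 : h (v + (-s - 1)) = h (v - s - 1) := congrArg h (by ring)
  have k1 : (1) * h (s + 1) * h (v + w - 1) * h (v - s) * h (w) + (-1) * h (1) * h (v + w - s - 1) * h (v) * h (w + s) + (-1) * h (w - 1) * h (v - s - 1) * h (v + w) * h (s) = 0 := by
    have := hb.three (w + s) w (-w + 1) (v - s - 1)
    have k1e0 : h (-w + 1 + (w + s)) = h (s + 1) := congrArg h (by ring)
    have k1e1 : h (v - s - 1 + (w + s)) = h (v + w - 1) := congrArg h (by ring)
    have k1e2 : h (-w + 1 + (v - s - 1) + w) = h (v - s) := congrArg h (by ring)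
    have k1e3 : h (-w + 1 + w) = h (1) := congrArg h (by ring)
    have k1e4 : h (v - s - 1 + w) = h (v + w - s - 1) := congrArg h (by ring)
    have k1e5 : h (-w + 1 + (v - s - 1) + (w + s)) = h (v) := congrArg h (by ring)
    have k1e6 : h (-w + 1) = -h (w - 1) := hb.ng (by ring)
    have k1e7 : h (-w + 1 + (v - s - 1) + (w + s) + w) = h (v + w) := congrArg h (by ring)
    have k1e8 : h (w - (w + s)) = -h (s) := hb.ng (by ring)
    simp only [k1e0, k1e1, k1e2, k1e3, k1e4, k1e5, k1e6, k1e7, k1e8] at this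
    linear_combination this
  simp only [n2, n3, e0, e1, e2, e3, e4, e5, e6, e7]
  linear_combination (norm := skip) (1) / h (s) / h (s) * h (1) / h (v + w - 1) / h (v - 1) / h (w - 1) * k1
  field_simp
  try ring

lemma ybe_211_211 {h : ℂ → ℂ} (hb : IsBracket h) (s v w : ℂ)
    (hd0 : h (v + w - 1) ≠ 0) (hd1 : h (v - 1) ≠ 0) (hd2 : h (w - 1) ≠ 0) (hz0 : h (s + 1) ≠ 0) (hz1 : h (s) ≠ 0) :
    1 * n3 h v (-s) * n3 h w (-s) + n3 h (v + w) (-s - 1) * n2 h v s * n2 h w (-s) =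
      n3 h (v + w) (-s) * 1 * 1 := by
  have e0 : h (1 - v) = -h (v - 1) := hb.ng (by ring)
  have e1 : h (-s) = -h (s) := hb.ng (by ring)
  have e2 : h (v + (-s)) = h (v - s) := congrArg h (by ring)
  have e3 : h (1 - w) = -h (w - 1) := hb.ng (by ring)
  have e4 : h (w + (-s)) = h (w - s) := congrArg h (by ring)
  have e5 : h (1 - (v + w)) = -h (v + w - 1) := hb.ng (by ring)
  have e6 : h (-s - 1) = -h (s + 1) := hb.ng (by ring)
  have e7 : h (v + w + (-s - 1)) = h (v + w - s - 1) := congrArg h (by ring)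
  have e8 : h (-s + 1) = -h (s - 1) := hb.ng (by ring)
  have e9 : h (v + w + (-s)) = h (v + w - s) := congrArg h (by ring)
  have k1 : (1) * h (v + w - 1) * h (w - s) * h (v - s) * h (1) + (1) * h (v) * h (s - 1) * h (v + w - s - 1) * h (w) + (-1) * h (v - 1) * h (s) * h (v + w - s) * h (w - 1) = 0 := by
    have := hb.three w 1 (v - 1) (-s)
    have k1e0 : h (v - 1 + w) = h (v + w - 1) := congrArg h (by ring)
    have k1e1 : h (-s + w) = h (w - s) := congrArg h (by ring)
    have k1e2 : h (v - 1 + (-s) + 1) = h (v - s) := congrArg h (by ring)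
    have k1e3 : h (v - 1 + 1) = h (v) := congrArg h (by ring)
    have k1e4 : h (-s + 1) = -h (s - 1) := hb.ng (by ring)
    have k1e5 : h (v - 1 + (-s) + w) = h (v + w - s - 1) := congrArg h (by ring)
    have k1e6 : h (-s) = -h (s) := hb.ng (by ring)
    have k1e7 : h (v - 1 + (-s) + w + 1) = h (v + w - s) := congrArg h (by ring)
    have k1e8 : h (1 - w) = -h (w - 1) := hb.ng (by ring)
    simp only [k1e0, k1e1, k1e2, k1e3, k1e4, k1e5, k1e6, k1e7, k1e8] at this
    linear_combination this
  simp only [n2, n3, e0, e1, e2, e3, e4, e5, e6, e7, e8, e9]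
  linear_combination (norm := skip) (1) / h (s) / h (s) * h (1) / h (v + w - 1) / h (v - 1) / h (w - 1) * k1
  field_simp
  try ring


/-! ### Combinatorics of the face weights -/

lemma ebar_inj {n : ℕ} {i j : Fin n} (h : ebar n i = ebar n j) : i = j := by
  have := congrFun h i
  by_contra hij
  simp [ebar, hij] at this

lemma add_ebar_inj {n : ℕ} {a : Fin n → ℝ} {i j : Fin n} (h : a + ebar n i = a + ebar n j) :
    i = j := ebar_inj (add_left_cancel h)

lemma ebar_two {n : ℕ} {i j l m : Fin n} (h : ebar n i + ebar n j = ebar n l + ebar n m) :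
    (l = i ∧ m = j) ∨ (l = j ∧ m = i) := by
  have hl : l = i ∨ l = j := by
    by_contra hc
    push Not at hc
    have := congrFun h l
    simp only [ebar, Pi.add_apply, if_neg hc.1, if_neg hc.2, if_true] at this
    split_ifs at this <;> linarith
  rcases hl with rfl | rfl
  · exact Or.inl ⟨rfl, (ebar_inj (add_left_cancel h)).symm⟩
  · rw [add_comm] at h
    exact Or.inr ⟨rfl, (ebar_inj (add_left_cancel h)).symm⟩

lemma ebar_three {n : ℕ} {i j k l m o : Fin n}
    (h : ebar n i + ebar n j + ebar n k = ebar n l + ebar n m + ebar n o) :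
    (l = i ∧ m = j) ∨ (l = i ∧ m = k) ∨ (l = j ∧ m = i) ∨ (l = j ∧ m = k) ∨
      (l = k ∧ m = i) ∨ (l = k ∧ m = j) := by
  have hl : l = i ∨ l = j ∨ l = k := by
    by_contra hc
    push Not at hc
    have := congrFun h l
    simp only [ebar, Pi.add_apply, if_neg hc.1, if_neg hc.2.1, if_neg hc.2.2, if_true] at this
    split_ifs at this <;> linarith
  rcases hl with rfl | rfl | rfl
  · have h' : ebar n j + ebar n k = ebar n m + ebar n o := by
      apply add_left_cancel (a := ebar n l)
      rw [← add_assoc, ← add_assoc, h]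
    rcases ebar_two h' with ⟨h1, _⟩ | ⟨h1, _⟩ <;> simp [h1]
  · have h' : ebar n i + ebar n k = ebar n m + ebar n o := by
      apply add_left_cancel (a := ebar n l)
      rw [← add_assoc, ← add_assoc, ← h]
      abel
    rcases ebar_two h' with ⟨h1, _⟩ | ⟨h1, _⟩ <;> simp [h1]
  · have h' : ebar n i + ebar n j = ebar n m + ebar n o := by
      apply add_left_cancel (a := ebar n l)
      rw [← add_assoc, ← add_assoc, ← h]
      abel
    rcases ebar_two h' with ⟨h1, _⟩ | ⟨h1, _⟩ <;> simp [h1]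

lemma PLat_add {n : ℕ} {a : Fin n → ℝ} (ha : a ∈ PLat n) (i : Fin n) : a + ebar n i ∈ PLat n := by
  obtain ⟨c, rfl⟩ := ha
  refine ⟨fun μ => c μ + if μ = i then 1 else 0, ?_⟩
  simp [add_smul, Finset.sum_add_distrib]

lemma abar_add {n : ℕ} (a : Fin n → ℝ) (κ μ ν : Fin n) :
    abar n (a + ebar n κ) μ - abar n (a + ebar n κ) ν =
      abar n a μ - abar n a ν + ((if μ = κ then 1 else 0) - (if ν = κ then 1 else 0)) := by
  simp only [abar, ebar, Pi.add_apply]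
  ring

section weights
variable {x r : ℝ} {n : ℕ} {v : ℂ} {a b c d : Fin n → ℝ}

lemma faceW_one (μ : Fin n) (hd : d = a + ebar n μ := by abel)
    (hb : b = a + ebar n μ := by abel) (hc : c = a + ebar n μ + ebar n μ := by abel) : faceW x r n v c d b a = rOne x r n v := by
  unfold faceW
  rw [dif_pos ⟨μ, hd, hb, hc⟩]

lemma faceW_two {A : ℂ} (μ ν : Fin n) (hne : μ ≠ ν := by assumption) (hd : d = a + ebar n μ := by abel)
    (hb : b = a + ebar n ν := by abel) (hc : c = a + ebar n μ + ebar n ν := by abel)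
    (hA : ((abar n a μ - abar n a ν : ℝ) : ℂ) = A := by
      subst_vars; simp [abar_add, *] <;> ring) :
    faceW x r n v c d b a = rOne x r n v * n2 (ebrk x r) v A := by
  unfold faceW
  have h1 : ¬ ∃ μ : Fin n, d = a + ebar n μ ∧ b = a + ebar n μ ∧ c = a + ebar n μ + ebar n μ := by
    rintro ⟨κ, e1, e2, -⟩
    exact hne ((add_ebar_inj (hd.symm.trans e1)).trans (add_ebar_inj (hb.symm.trans e2)).symm)
  have h2 : ∃ p : Fin n × Fin n, p.1 ≠ p.2 ∧ d = a + ebar n p.1 ∧ b = a + ebar n p.2 ∧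
      c = a + ebar n p.1 + ebar n p.2 := ⟨(μ, ν), hne, hd, hb, hc⟩
  rw [dif_neg h1, dif_pos h2]
  obtain ⟨-, e1, e2, -⟩ := h2.choose_spec
  rw [← add_ebar_inj (hd.symm.trans e1), ← add_ebar_inj (hb.symm.trans e2), hA, n2]
  ring

lemma faceW_three {A : ℂ} (μ ν : Fin n) (hne : μ ≠ ν := by assumption) (hd : d = a + ebar n μ := by abel)
    (hb : b = a + ebar n μ := by abel) (hc : c = a + ebar n μ + ebar n ν := by abel)
    (hA : ((abar n a μ - abar n a ν : ℝ) : ℂ) = A := by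
      subst_vars; simp [abar_add, *] <;> ring) :
    faceW x r n v c d b a = rOne x r n v * n3 (ebrk x r) v A := by
  unfold faceW
  have h1 : ¬ ∃ μ : Fin n, d = a + ebar n μ ∧ b = a + ebar n μ ∧ c = a + ebar n μ + ebar n μ := by
    rintro ⟨κ, e1, e2, e3⟩
    have := add_ebar_inj (hd.symm.trans e1)
    subst this
    exact hne (add_ebar_inj (hc.symm.trans e3)).symm
  have h2 : ¬ ∃ p : Fin n × Fin n, p.1 ≠ p.2 ∧ d = a + ebar n p.1 ∧ b = a + ebar n p.2 ∧
      c = a + ebar n p.1 + ebar n p.2 := by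
    rintro ⟨p, hp, e1, e2, -⟩
    exact hp ((add_ebar_inj (hd.symm.trans e1)).symm.trans (add_ebar_inj (hb.symm.trans e2)))
  have h3 : ∃ p : Fin n × Fin n, p.1 ≠ p.2 ∧ d = a + ebar n p.1 ∧ b = a + ebar n p.1 ∧
      c = a + ebar n p.1 + ebar n p.2 := ⟨(μ, ν), hne, hd, hb, hc⟩
  rw [dif_neg h1, dif_neg h2, dif_pos h3]
  obtain ⟨-, e1, -, e3⟩ := h3.choose_spec
  have e4 := add_ebar_inj (hd.symm.trans e1)
  rw [← e4] at e3
  rw [← e4, ← add_ebar_inj (hc.symm.trans e3), hA, n3]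
  ring

lemma faceW_supp (h : faceW x r n v c d b a ≠ 0) : ∃ μ ν : Fin n, d = a + ebar n μ ∧
    c = a + ebar n μ + ebar n ν ∧ (b = a + ebar n μ ∨ b = a + ebar n ν) := by
  unfold faceW at h
  split_ifs at h with h1 h2 h3
  · obtain ⟨μ, e1, e2, e3⟩ := h1
    exact ⟨μ, μ, e1, e3, Or.inl e2⟩
  · obtain ⟨p, -, e1, e2, e3⟩ := h2
    exact ⟨p.1, p.2, e1, e3, Or.inr e2⟩
  · obtain ⟨p, -, e1, e2, e3⟩ := h3
    exact ⟨p.1, p.2, e1, e3, Or.inl e2⟩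
  · exact absurd rfl h

/-- Nonzero weights come from admissible squares. -/
lemma faceW_adm (h : faceW x r n v c d b a ≠ 0) : (∃ μ, d = a + ebar n μ) ∧ (∃ μ, b = a + ebar n μ) ∧
    (∃ μ, c = d + ebar n μ) ∧ (∃ μ, c = b + ebar n μ) := by
  obtain ⟨μ, ν, rfl, rfl, rfl | rfl⟩ := faceW_supp h
  · exact ⟨⟨μ, rfl⟩, ⟨μ, rfl⟩, ⟨ν, rfl⟩, ⟨ν, rfl⟩⟩
  · exact ⟨⟨μ, rfl⟩, ⟨ν, rfl⟩, ⟨ν, rfl⟩, ⟨μ, by abel⟩⟩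

lemma faceW_supp_d (i j : Fin n) (hc : c = a + ebar n i + ebar n j)
    (h : faceW x r n v c d b a ≠ 0) : d = a + ebar n i ∨ d = a + ebar n j := by
  obtain ⟨μ, ν, rfl, h2, -⟩ := faceW_supp h
  rw [hc, add_assoc, add_assoc] at h2
  rcases ebar_two (add_left_cancel h2) with ⟨e, -⟩ | ⟨e, -⟩ <;> simp [e]

lemma faceW_zero_d (i j k : Fin n) (h1 : k ≠ i) (h2 : k ≠ j) (hc : c = a + ebar n i + ebar n j)
    (hd : d = a + ebar n k) : faceW x r n v c d b a = 0 := by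
  by_contra h
  rcases faceW_supp_d i j hc h with h | h
  · exact h1 (add_ebar_inj (hd.symm.trans h))
  · exact h2 (add_ebar_inj (hd.symm.trans h))

lemma faceW_zero_b (i j k : Fin n) (h1 : k ≠ i) (h2 : k ≠ j) (hc : c = a + ebar n i + ebar n j)
    (hb : b = a + ebar n k) : faceW x r n v c d b a = 0 := by
  by_contra h
  obtain ⟨μ, ν, rfl, h3, h4⟩ := faceW_supp h
  rw [hc, add_assoc, add_assoc] at h3
  have h5 : k = μ ∨ k = ν := h4.imp (fun h => add_ebar_inj (hb.symm.trans h))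
    (fun h => add_ebar_inj (hb.symm.trans h))
  rcases ebar_two (add_left_cancel h3) with ⟨rfl, rfl⟩ | ⟨rfl, rfl⟩ <;> tauto

end weights

lemma tsum_one {n : ℕ} (φ : (Fin n → ℝ) → ℂ) (p : Fin n → ℝ) (hp : p ∈ PLat n)
    (h : ∀ g, φ g ≠ 0 → g = p ∨ g = p) : ∑' g : PLat n, φ g = φ p := by
  rw [tsum_eq_single (⟨p, hp⟩ : PLat n)]
  intro g hg
  by_contra h0
  rcases h _ h0 with h | h <;> exact hg (Subtype.ext h)

lemma tsum_two {n : ℕ} (φ : (Fin n → ℝ) → ℂ) (p q : Fin n → ℝ) (hpq : p ≠ q) (hp : p ∈ PLat n)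
    (hq : q ∈ PLat n) (h : ∀ g, φ g ≠ 0 → g = p ∨ g = q) : ∑' g : PLat n, φ g = φ p + φ q := by
  classical
  have hne : (⟨p, hp⟩ : PLat n) ≠ ⟨q, hq⟩ := fun h => hpq (congrArg Subtype.val h)
  rw [tsum_eq_sum (s := {(⟨p, hp⟩ : PLat n), ⟨q, hq⟩}), Finset.sum_pair hne]
  intro g hg
  by_contra h0
  apply hg
  rcases h _ h0 with h | h
  · simp [Subtype.ext_iff, h]
  · simp [Subtype.ext_iff, h]

/-- Summand of the left-hand side. -/
def lhsF (x r : ℝ) (n : ℕ) (v w : ℂ) (a b c d e f g : Fin n → ℝ) : ℂ :=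
  faceW x r n (v + w) d e c g * faceW x r n v c g b a * faceW x r n w e f g a

/-- Summand of the right-hand side. -/
def rhsF (x r : ℝ) (n : ℕ) (v w : ℂ) (a b c d e f g : Fin n → ℝ) : ℂ :=
  faceW x r n (v + w) g f b a * faceW x r n v d e g f * faceW x r n w d g c b

lemma lhsF_supp {x r : ℝ} {n : ℕ} {v w : ℂ} {a b d e f : Fin n → ℝ} (i j : Fin n) (g : Fin n → ℝ)
    (h : lhsF x r n v w a b (a + ebar n i + ebar n j) d e f g ≠ 0) :
    g = a + ebar n i ∨ g = a + ebar n j :=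
  faceW_supp_d i j rfl (right_ne_zero_of_mul (left_ne_zero_of_mul h))

lemma rhsF_supp {x r : ℝ} {n : ℕ} {v w : ℂ} {a b c e f : Fin n → ℝ} (j k : Fin n) (g : Fin n → ℝ)
    (h : rhsF x r n v w a b c (b + ebar n j + ebar n k) e f g ≠ 0) :
    g = b + ebar n j ∨ g = b + ebar n k :=
  faceW_supp_d j k rfl (right_ne_zero_of_mul h)

/-- The Yang-Baxter equation at a given hexagon. -/
def YBE (x r : ℝ) (n : ℕ) (v w : ℂ) (a b c d e f : Fin n → ℝ) : Prop :=
  ∑' g : PLat n, lhsF x r n v w a b c d e f g = ∑' g : PLat n, rhsF x r n v w a b c d e f g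

lemma ne_add {n : ℕ} (a : Fin n → ℝ) {i j : Fin n} (h : i ≠ j) : a + ebar n i ≠ a + ebar n j :=
  fun e => h (add_ebar_inj e)

section cases
variable {x r : ℝ} {n : ℕ} {v w : ℂ} {a : Fin n → ℝ}

/-- Genericity of the spectral parameters. -/
structure Gen (x r : ℝ) (v w : ℂ) : Prop where
  H : IsBracket (ebrk x r)
  d0 : ebrk x r (v + w - 1) ≠ 0
  d1 : ebrk x r (v - 1) ≠ 0
  d2 : ebrk x r (w - 1) ≠ 0

/-- Three distinct directions, with regularity at `a`. -/
def Distinct (x r : ℝ) (a : Fin n → ℝ) (i j k : Fin n) : Prop :=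
  i ≠ j ∧ j ≠ i ∧ j ≠ k ∧ k ≠ j ∧ i ≠ k ∧ k ≠ i ∧ ∃ s t : ℂ,
    ((abar n a i - abar n a j : ℝ) : ℂ) = s ∧ ((abar n a j - abar n a k : ℝ) : ℂ) = t ∧
    ebrk x r (s + t) ≠ 0 ∧ ebrk x r s ≠ 0 ∧ ebrk x r t ≠ 0

/-- Two distinct directions, with regularity. -/
def Pair (x r : ℝ) (a : Fin n → ℝ) (i j : Fin n) : Prop :=
  i ≠ j ∧ j ≠ i ∧ ∃ s : ℂ, ((abar n a i - abar n a j : ℝ) : ℂ) = s ∧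
    ebrk x r (s + 1) ≠ 0 ∧ ebrk x r s ≠ 0

local notation:65 a:65 "⊹" i:66 => a + ebar _ i
local notation "𝔴" => faceW x r n
local notation "𝔯" => rOne x r n
local notation "𝔟" => n2 (ebrk x r)
local notation "𝔠" => n3 (ebrk x r)

variable {i j k : Fin n} {e f : Fin n → ℝ}

lemma YBE_ne_ne (hij : i ≠ j) (hjk : j ≠ k) (ha : a ∈ PLat n)
    (h :
      𝔴 (v + w) (a⊹i⊹j⊹k) e (a⊹i⊹j) (a⊹i) * 𝔴 v (a⊹i⊹j) (a⊹i) (a⊹i) a * 𝔴 w e f (a⊹i) a +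
      𝔴 (v + w) (a⊹i⊹j⊹k) e (a⊹i⊹j) (a⊹j) * 𝔴 v (a⊹i⊹j) (a⊹j) (a⊹i) a * 𝔴 w e f (a⊹j) a =
      𝔴 (v + w) (a⊹i⊹j) f (a⊹i) a * 𝔴 v (a⊹i⊹j⊹k) e (a⊹i⊹j) f * 𝔴 w (a⊹i⊹j⊹k) (a⊹i⊹j) (a⊹i⊹j) (a⊹i) +
      𝔴 (v + w) (a⊹i⊹k) f (a⊹i) a * 𝔴 v (a⊹i⊹j⊹k) e (a⊹i⊹k) f * 𝔴 w (a⊹i⊹j⊹k) (a⊹i⊹k) (a⊹i⊹j) (a⊹i)) :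
    YBE x r n v w a (a⊹i) (a⊹i⊹j) (a⊹i⊹j⊹k) e f := by
  unfold YBE
  rw [tsum_two _ (a⊹i) (a⊹j) (ne_add a hij)
      (PLat_add ha _) (PLat_add ha _) (lhsF_supp i j),
    tsum_two _ (a⊹i⊹j) (a⊹i⊹k) (ne_add (a⊹i) hjk)
      (PLat_add (PLat_add ha _) _) (PLat_add (PLat_add ha _) _) (rhsF_supp j k)]
  exact h

lemma YBE_eq_ne (hjk : i ≠ k) (ha : a ∈ PLat n)
    (h :
      𝔴 (v + w) (a⊹i⊹i⊹k) e (a⊹i⊹i) (a⊹i) * 𝔴 v (a⊹i⊹i) (a⊹i) (a⊹i) a * 𝔴 w e f (a⊹i) a =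
      𝔴 (v + w) (a⊹i⊹i) f (a⊹i) a * 𝔴 v (a⊹i⊹i⊹k) e (a⊹i⊹i) f * 𝔴 w (a⊹i⊹i⊹k) (a⊹i⊹i) (a⊹i⊹i) (a⊹i) +
      𝔴 (v + w) (a⊹i⊹k) f (a⊹i) a * 𝔴 v (a⊹i⊹i⊹k) e (a⊹i⊹k) f * 𝔴 w (a⊹i⊹i⊹k) (a⊹i⊹k) (a⊹i⊹i) (a⊹i)) :
    YBE x r n v w a (a⊹i) (a⊹i⊹i) (a⊹i⊹i⊹k) e f := by
  unfold YBE
  rw [tsum_one _ (a⊹i) (PLat_add ha _) (lhsF_supp i i),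
    tsum_two _ (a⊹i⊹i) (a⊹i⊹k) (ne_add (a⊹i) hjk)
      (PLat_add (PLat_add ha _) _) (PLat_add (PLat_add ha _) _) (rhsF_supp i k)]
  exact h

lemma YBE_ne_eq (hij : i ≠ j) (ha : a ∈ PLat n)
    (h :
      𝔴 (v + w) (a⊹i⊹j⊹j) e (a⊹i⊹j) (a⊹i) * 𝔴 v (a⊹i⊹j) (a⊹i) (a⊹i) a * 𝔴 w e f (a⊹i) a +
      𝔴 (v + w) (a⊹i⊹j⊹j) e (a⊹i⊹j) (a⊹j) * 𝔴 v (a⊹i⊹j) (a⊹j) (a⊹i) a * 𝔴 w e f (a⊹j) a =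
      𝔴 (v + w) (a⊹i⊹j) f (a⊹i) a * 𝔴 v (a⊹i⊹j⊹j) e (a⊹i⊹j) f * 𝔴 w (a⊹i⊹j⊹j) (a⊹i⊹j) (a⊹i⊹j) (a⊹i)) :
    YBE x r n v w a (a⊹i) (a⊹i⊹j) (a⊹i⊹j⊹j) e f := by
  unfold YBE
  rw [tsum_two _ (a⊹i) (a⊹j) (ne_add a hij)
      (PLat_add ha _) (PLat_add ha _) (lhsF_supp i j),
    tsum_one _ (a⊹i⊹j) (PLat_add (PLat_add ha _) _) (rhsF_supp j j)]
  exact h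

lemma case_iii (ha : a ∈ PLat n) :
    YBE x r n v w a (a⊹i) (a⊹i⊹i) (a⊹i⊹i⊹i) (a⊹i⊹i) (a⊹i) := by
  unfold YBE
  rw [tsum_one _ (a⊹i) (PLat_add ha _) (lhsF_supp i i),
    tsum_one _ (a⊹i⊹i) (PLat_add (PLat_add ha _) _) (rhsF_supp i i)]
  simp only [lhsF, rhsF]
  have w0 (u : ℂ) : 𝔴 u (a⊹i⊹i⊹i) (a⊹i⊹i) (a⊹i⊹i) (a⊹i) = 𝔯 u := faceW_one i
  have w1 (u : ℂ) : 𝔴 u (a⊹i⊹i) (a⊹i) (a⊹i) a = 𝔯 u := faceW_one i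
  simp only [w0, w1]
 
lemma case_123_123 (G : Gen x r v w) (ha : a ∈ PLat n) {i j k : Fin n} (T : Distinct x r a i j k) :
    YBE x r n v w a (a⊹i) (a⊹i⊹j)
      (a⊹i⊹j⊹k) (a⊹i⊹j) (a⊹i) := by
  obtain ⟨hij, hji, hjk, hkj, hik, hki, s, t, hs, ht, z0, z1, z2⟩ := T
  refine YBE_ne_ne hij hjk ha ?_
  have w0 : 𝔴 (v + w) (a⊹i⊹j⊹k) (a⊹i⊹j) (a⊹i⊹j) (a⊹i) = 𝔯 (v + w) * 𝔠 (v + w) t := faceW_three j k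
  have w1 : 𝔴 v (a⊹i⊹j) (a⊹i) (a⊹i) a = 𝔯 v * 𝔠 v s := faceW_three i j
  have w2 : 𝔴 w (a⊹i⊹j) (a⊹i) (a⊹i) a = 𝔯 w * 𝔠 w s := faceW_three i j
  have w3 : 𝔴 (v + w) (a⊹i⊹j⊹k) (a⊹i⊹j) (a⊹i⊹j) (a⊹j) = 𝔯 (v + w) * 𝔠 (v + w) (s + t) := faceW_three i k
  have w4 : 𝔴 v (a⊹i⊹j) (a⊹j) (a⊹i) a = 𝔯 v * 𝔟 v (-s) := faceW_two j i
  have w5 : 𝔴 w (a⊹i⊹j) (a⊹i) (a⊹j) a = 𝔯 w * 𝔟 w s := faceW_two i j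
  have w6 : 𝔴 (v + w) (a⊹i⊹j) (a⊹i) (a⊹i) a = 𝔯 (v + w) * 𝔠 (v + w) s := faceW_three i j
  have w7 : 𝔴 v (a⊹i⊹j⊹k) (a⊹i⊹j) (a⊹i⊹j) (a⊹i) = 𝔯 v * 𝔠 v t := faceW_three j k
  have w8 : 𝔴 w (a⊹i⊹j⊹k) (a⊹i⊹j) (a⊹i⊹j) (a⊹i) = 𝔯 w * 𝔠 w t := faceW_three j k
  have w9 : 𝔴 (v + w) (a⊹i⊹k) (a⊹i) (a⊹i) a = 𝔯 (v + w) * 𝔠 (v + w) (s + t) := faceW_three i k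
  have w10 : 𝔴 v (a⊹i⊹j⊹k) (a⊹i⊹j) (a⊹i⊹k) (a⊹i) = 𝔯 v * 𝔟 v t := faceW_two j k
  have w11 : 𝔴 w (a⊹i⊹j⊹k) (a⊹i⊹k) (a⊹i⊹j) (a⊹i) = 𝔯 w * 𝔟 w (-t) := faceW_two k j
  rw [w0, w1, w2, w3, w4, w5, w6, w7, w8, w9, w10, w11]
  linear_combination 𝔯 (v + w) * 𝔯 v * 𝔯 w *
    ybe_123_123 G.H s t v w G.d0 G.d1 G.d2 z0 z1 z2

lemma case_123_132 (G : Gen x r v w) (ha : a ∈ PLat n) {i j k : Fin n} (T : Distinct x r a i j k) :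
    YBE x r n v w a (a⊹i) (a⊹i⊹j)
      (a⊹i⊹j⊹k) (a⊹i⊹k) (a⊹i) := by
  obtain ⟨hij, hji, hjk, hkj, hik, hki, s, t, hs, ht, z0, z1, z2⟩ := T
  refine YBE_ne_ne hij hjk ha ?_
  have w0 : 𝔴 (v + w) (a⊹i⊹j⊹k) (a⊹i⊹k) (a⊹i⊹j) (a⊹i) = 𝔯 (v + w) * 𝔟 (v + w) (-t) := faceW_two k j
  have w1 : 𝔴 v (a⊹i⊹j) (a⊹i) (a⊹i) a = 𝔯 v * 𝔠 v s := faceW_three i j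
  have w2 : 𝔴 w (a⊹i⊹k) (a⊹i) (a⊹i) a = 𝔯 w * 𝔠 w (s + t) := faceW_three i k
  have w3 : 𝔴 w (a⊹i⊹k) (a⊹i) (a⊹j) a = 0 := faceW_zero_b i k j hji hjk rfl rfl
  have w4 : 𝔴 (v + w) (a⊹i⊹j) (a⊹i) (a⊹i) a = 𝔯 (v + w) * 𝔠 (v + w) s := faceW_three i j
  have w5 : 𝔴 v (a⊹i⊹j⊹k) (a⊹i⊹k) (a⊹i⊹j) (a⊹i) = 𝔯 v * 𝔟 v (-t) := faceW_two k j
  have w6 : 𝔴 w (a⊹i⊹j⊹k) (a⊹i⊹j) (a⊹i⊹j) (a⊹i) = 𝔯 w * 𝔠 w t := faceW_three j k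
  have w7 : 𝔴 (v + w) (a⊹i⊹k) (a⊹i) (a⊹i) a = 𝔯 (v + w) * 𝔠 (v + w) (s + t) := faceW_three i k
  have w8 : 𝔴 v (a⊹i⊹j⊹k) (a⊹i⊹k) (a⊹i⊹k) (a⊹i) = 𝔯 v * 𝔠 v (-t) := faceW_three k j
  have w9 : 𝔴 w (a⊹i⊹j⊹k) (a⊹i⊹k) (a⊹i⊹j) (a⊹i) = 𝔯 w * 𝔟 w (-t) := faceW_two k j
  rw [w0, w1, w2, w3, w4, w5, w6, w7, w8, w9]
  linear_combination 𝔯 (v + w) * 𝔯 v * 𝔯 w *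
    ybe_123_132 G.H s t v w G.d0 G.d1 G.d2 z0 z1 z2

lemma case_123_213 (G : Gen x r v w) (ha : a ∈ PLat n) {i j k : Fin n} (T : Distinct x r a i j k) :
    YBE x r n v w a (a⊹i) (a⊹i⊹j)
      (a⊹i⊹j⊹k) (a⊹j⊹i) (a⊹j) := by
  obtain ⟨hij, hji, hjk, hkj, hik, hki, s, t, hs, ht, z0, z1, z2⟩ := T
  refine YBE_ne_ne hij hjk ha ?_
  have w0 : 𝔴 (v + w) (a⊹i⊹j⊹k) (a⊹j⊹i) (a⊹i⊹j) (a⊹i) = 𝔯 (v + w) * 𝔠 (v + w) t := faceW_three j k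
  have w1 : 𝔴 v (a⊹i⊹j) (a⊹i) (a⊹i) a = 𝔯 v * 𝔠 v s := faceW_three i j
  have w2 : 𝔴 w (a⊹j⊹i) (a⊹j) (a⊹i) a = 𝔯 w * 𝔟 w (-s) := faceW_two j i
  have w3 : 𝔴 (v + w) (a⊹i⊹j⊹k) (a⊹j⊹i) (a⊹i⊹j) (a⊹j) = 𝔯 (v + w) * 𝔠 (v + w) (s + t) := faceW_three i k
  have w4 : 𝔴 v (a⊹i⊹j) (a⊹j) (a⊹i) a = 𝔯 v * 𝔟 v (-s) := faceW_two j i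
  have w5 : 𝔴 w (a⊹j⊹i) (a⊹j) (a⊹j) a = 𝔯 w * 𝔠 w (-s) := faceW_three j i
  have w6 : 𝔴 (v + w) (a⊹i⊹j) (a⊹j) (a⊹i) a = 𝔯 (v + w) * 𝔟 (v + w) (-s) := faceW_two j i
  have w7 : 𝔴 v (a⊹i⊹j⊹k) (a⊹j⊹i) (a⊹i⊹j) (a⊹j) = 𝔯 v * 𝔠 v (s + t) := faceW_three i k
  have w8 : 𝔴 w (a⊹i⊹j⊹k) (a⊹i⊹j) (a⊹i⊹j) (a⊹i) = 𝔯 w * 𝔠 w t := faceW_three j k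
  have w9 : 𝔴 (v + w) (a⊹i⊹k) (a⊹j) (a⊹i) a = 0 := faceW_zero_d i k j hji hjk rfl rfl
  rw [w0, w1, w2, w3, w4, w5, w6, w7, w8, w9]
  linear_combination 𝔯 (v + w) * 𝔯 v * 𝔯 w *
    ybe_123_213 G.H s t v w G.d0 G.d1 G.d2 z0 z1 z2

lemma case_123_231 (G : Gen x r v w) (ha : a ∈ PLat n) {i j k : Fin n} (T : Distinct x r a i j k) :
    YBE x r n v w a (a⊹i) (a⊹i⊹j)
      (a⊹i⊹j⊹k) (a⊹j⊹k) (a⊹j) := by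
  obtain ⟨hij, hji, hjk, hkj, hik, hki, s, t, hs, ht, z0, z1, z2⟩ := T
  refine YBE_ne_ne hij hjk ha ?_
  have w0 : 𝔴 w (a⊹j⊹k) (a⊹j) (a⊹i) a = 0 := faceW_zero_b j k i hij hik rfl rfl
  have w1 : 𝔴 (v + w) (a⊹i⊹j⊹k) (a⊹j⊹k) (a⊹i⊹j) (a⊹j) = 𝔯 (v + w) * 𝔟 (v + w) (-s - t) := faceW_two k i
  have w2 : 𝔴 v (a⊹i⊹j) (a⊹j) (a⊹i) a = 𝔯 v * 𝔟 v (-s) := faceW_two j i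
  have w3 : 𝔴 w (a⊹j⊹k) (a⊹j) (a⊹j) a = 𝔯 w * 𝔠 w t := faceW_three j k
  have w4 : 𝔴 (v + w) (a⊹i⊹j) (a⊹j) (a⊹i) a = 𝔯 (v + w) * 𝔟 (v + w) (-s) := faceW_two j i
  have w5 : 𝔴 v (a⊹i⊹j⊹k) (a⊹j⊹k) (a⊹i⊹j) (a⊹j) = 𝔯 v * 𝔟 v (-s - t) := faceW_two k i
  have w6 : 𝔴 w (a⊹i⊹j⊹k) (a⊹i⊹j) (a⊹i⊹j) (a⊹i) = 𝔯 w * 𝔠 w t := faceW_three j k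
  have w7 : 𝔴 (v + w) (a⊹i⊹k) (a⊹j) (a⊹i) a = 0 := faceW_zero_d i k j hji hjk rfl rfl
  rw [w0, w1, w2, w3, w4, w5, w6, w7]
  linear_combination 𝔯 (v + w) * 𝔯 v * 𝔯 w *
    ybe_123_231 G.H s t v w G.d0 G.d1 G.d2 z0 z1 z2

lemma case_123_312 (G : Gen x r v w) (ha : a ∈ PLat n) {i j k : Fin n} (T : Distinct x r a i j k) :
    YBE x r n v w a (a⊹i) (a⊹i⊹j)
      (a⊹i⊹j⊹k) (a⊹k⊹i) (a⊹k) := by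
  obtain ⟨hij, hji, hjk, hkj, hik, hki, s, t, hs, ht, z0, z1, z2⟩ := T
  refine YBE_ne_ne hij hjk ha ?_
  have w0 : 𝔴 (v + w) (a⊹i⊹j⊹k) (a⊹k⊹i) (a⊹i⊹j) (a⊹i) = 𝔯 (v + w) * 𝔟 (v + w) (-t) := faceW_two k j
  have w1 : 𝔴 v (a⊹i⊹j) (a⊹i) (a⊹i) a = 𝔯 v * 𝔠 v s := faceW_three i j
  have w2 : 𝔴 w (a⊹k⊹i) (a⊹k) (a⊹i) a = 𝔯 w * 𝔟 w (-s - t) := faceW_two k i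
  have w3 : 𝔴 w (a⊹k⊹i) (a⊹k) (a⊹j) a = 0 := faceW_zero_b k i j hjk hji rfl rfl
  have w4 : 𝔴 (v + w) (a⊹i⊹j) (a⊹k) (a⊹i) a = 0 := faceW_zero_d i j k hki hkj rfl rfl
  have w5 : 𝔴 (v + w) (a⊹i⊹k) (a⊹k) (a⊹i) a = 𝔯 (v + w) * 𝔟 (v + w) (-s - t) := faceW_two k i
  have w6 : 𝔴 v (a⊹i⊹j⊹k) (a⊹k⊹i) (a⊹i⊹k) (a⊹k) = 𝔯 v * 𝔠 v s := faceW_three i j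
  have w7 : 𝔴 w (a⊹i⊹j⊹k) (a⊹i⊹k) (a⊹i⊹j) (a⊹i) = 𝔯 w * 𝔟 w (-t) := faceW_two k j
  rw [w0, w1, w2, w3, w4, w5, w6, w7]
  linear_combination 𝔯 (v + w) * 𝔯 v * 𝔯 w *
    ybe_123_312 G.H s t v w G.d0 G.d1 G.d2 z0 z1 z2

lemma case_123_321 (G : Gen x r v w) (ha : a ∈ PLat n) {i j k : Fin n} (T : Distinct x r a i j k) :
    YBE x r n v w a (a⊹i) (a⊹i⊹j)
      (a⊹i⊹j⊹k) (a⊹k⊹j) (a⊹k) := by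
  obtain ⟨hij, hji, hjk, hkj, hik, hki, s, t, hs, ht, z0, z1, z2⟩ := T
  refine YBE_ne_ne hij hjk ha ?_
  have w0 : 𝔴 w (a⊹k⊹j) (a⊹k) (a⊹i) a = 0 := faceW_zero_b k j i hik hij rfl rfl
  have w1 : 𝔴 (v + w) (a⊹i⊹j⊹k) (a⊹k⊹j) (a⊹i⊹j) (a⊹j) = 𝔯 (v + w) * 𝔟 (v + w) (-s - t) := faceW_two k i
  have w2 : 𝔴 v (a⊹i⊹j) (a⊹j) (a⊹i) a = 𝔯 v * 𝔟 v (-s) := faceW_two j i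
  have w3 : 𝔴 w (a⊹k⊹j) (a⊹k) (a⊹j) a = 𝔯 w * 𝔟 w (-t) := faceW_two k j
  have w4 : 𝔴 (v + w) (a⊹i⊹j) (a⊹k) (a⊹i) a = 0 := faceW_zero_d i j k hki hkj rfl rfl
  have w5 : 𝔴 (v + w) (a⊹i⊹k) (a⊹k) (a⊹i) a = 𝔯 (v + w) * 𝔟 (v + w) (-s - t) := faceW_two k i
  have w6 : 𝔴 v (a⊹i⊹j⊹k) (a⊹k⊹j) (a⊹i⊹k) (a⊹k) = 𝔯 v * 𝔟 v (-s) := faceW_two j i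
  have w7 : 𝔴 w (a⊹i⊹j⊹k) (a⊹i⊹k) (a⊹i⊹j) (a⊹i) = 𝔯 w * 𝔟 w (-t) := faceW_two k j
  rw [w0, w1, w2, w3, w4, w5, w6, w7]
  linear_combination 𝔯 (v + w) * 𝔯 v * 𝔯 w *
    ybe_123_321 G.H s t v w G.d0 G.d1 G.d2 z0 z1 z2

lemma case_112_112 (G : Gen x r v w) (ha : a ∈ PLat n) {i j : Fin n} (T : Pair x r a i j) :
    YBE x r n v w a (a⊹i) (a⊹i⊹i)
      (a⊹i⊹i⊹j) (a⊹i⊹i) (a⊹i) := by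
  obtain ⟨hij, hji, s, hs, z0, z1⟩ := T
  refine YBE_eq_ne hij ha ?_
  have w0 : 𝔴 (v + w) (a⊹i⊹i⊹j) (a⊹i⊹i) (a⊹i⊹i) (a⊹i) = 𝔯 (v + w) * 𝔠 (v + w) (s + 1) := faceW_three i j
  have w1 : 𝔴 v (a⊹i⊹i) (a⊹i) (a⊹i) a = 𝔯 v := faceW_one i
  have w2 : 𝔴 w (a⊹i⊹i) (a⊹i) (a⊹i) a = 𝔯 w := faceW_one i
  have w3 : 𝔴 (v + w) (a⊹i⊹i) (a⊹i) (a⊹i) a = 𝔯 (v + w) := faceW_one i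
  have w4 : 𝔴 v (a⊹i⊹i⊹j) (a⊹i⊹i) (a⊹i⊹i) (a⊹i) = 𝔯 v * 𝔠 v (s + 1) := faceW_three i j
  have w5 : 𝔴 w (a⊹i⊹i⊹j) (a⊹i⊹i) (a⊹i⊹i) (a⊹i) = 𝔯 w * 𝔠 w (s + 1) := faceW_three i j
  have w6 : 𝔴 (v + w) (a⊹i⊹j) (a⊹i) (a⊹i) a = 𝔯 (v + w) * 𝔠 (v + w) s := faceW_three i j
  have w7 : 𝔴 v (a⊹i⊹i⊹j) (a⊹i⊹i) (a⊹i⊹j) (a⊹i) = 𝔯 v * 𝔟 v (s + 1) := faceW_two i j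
  have w8 : 𝔴 w (a⊹i⊹i⊹j) (a⊹i⊹j) (a⊹i⊹i) (a⊹i) = 𝔯 w * 𝔟 w (-s - 1) := faceW_two j i
  rw [w0, w1, w2, w3, w4, w5, w6, w7, w8]
  linear_combination 𝔯 (v + w) * 𝔯 v * 𝔯 w *
    ybe_112_112 G.H s v w G.d0 G.d1 G.d2 z0 z1

lemma case_112_121 (G : Gen x r v w) (ha : a ∈ PLat n) {i j : Fin n} (T : Pair x r a i j) :
    YBE x r n v w a (a⊹i) (a⊹i⊹i)
      (a⊹i⊹i⊹j) (a⊹i⊹j) (a⊹i) := by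
  obtain ⟨hij, hji, s, hs, z0, z1⟩ := T
  refine YBE_eq_ne hij ha ?_
  have w0 : 𝔴 (v + w) (a⊹i⊹i⊹j) (a⊹i⊹j) (a⊹i⊹i) (a⊹i) = 𝔯 (v + w) * 𝔟 (v + w) (-s - 1) := faceW_two j i
  have w1 : 𝔴 v (a⊹i⊹i) (a⊹i) (a⊹i) a = 𝔯 v := faceW_one i
  have w2 : 𝔴 w (a⊹i⊹j) (a⊹i) (a⊹i) a = 𝔯 w * 𝔠 w s := faceW_three i j
  have w3 : 𝔴 (v + w) (a⊹i⊹i) (a⊹i) (a⊹i) a = 𝔯 (v + w) := faceW_one i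
  have w4 : 𝔴 v (a⊹i⊹i⊹j) (a⊹i⊹j) (a⊹i⊹i) (a⊹i) = 𝔯 v * 𝔟 v (-s - 1) := faceW_two j i
  have w5 : 𝔴 w (a⊹i⊹i⊹j) (a⊹i⊹i) (a⊹i⊹i) (a⊹i) = 𝔯 w * 𝔠 w (s + 1) := faceW_three i j
  have w6 : 𝔴 (v + w) (a⊹i⊹j) (a⊹i) (a⊹i) a = 𝔯 (v + w) * 𝔠 (v + w) s := faceW_three i j
  have w7 : 𝔴 v (a⊹i⊹i⊹j) (a⊹i⊹j) (a⊹i⊹j) (a⊹i) = 𝔯 v * 𝔠 v (-s - 1) := faceW_three j i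
  have w8 : 𝔴 w (a⊹i⊹i⊹j) (a⊹i⊹j) (a⊹i⊹i) (a⊹i) = 𝔯 w * 𝔟 w (-s - 1) := faceW_two j i
  rw [w0, w1, w2, w3, w4, w5, w6, w7, w8]
  linear_combination 𝔯 (v + w) * 𝔯 v * 𝔯 w *
    ybe_112_121 G.H s v w G.d0 G.d1 G.d2 z0 z1

lemma case_112_211 (G : Gen x r v w) (ha : a ∈ PLat n) {i j : Fin n} (T : Pair x r a i j) :
    YBE x r n v w a (a⊹i) (a⊹i⊹i)
      (a⊹i⊹i⊹j) (a⊹j⊹i) (a⊹j) := by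
  obtain ⟨hij, hji, s, hs, z0, z1⟩ := T
  refine YBE_eq_ne hij ha ?_
  have w0 : 𝔴 (v + w) (a⊹i⊹i⊹j) (a⊹j⊹i) (a⊹i⊹i) (a⊹i) = 𝔯 (v + w) * 𝔟 (v + w) (-s - 1) := faceW_two j i
  have w1 : 𝔴 v (a⊹i⊹i) (a⊹i) (a⊹i) a = 𝔯 v := faceW_one i
  have w2 : 𝔴 w (a⊹j⊹i) (a⊹j) (a⊹i) a = 𝔯 w * 𝔟 w (-s) := faceW_two j i
  have w3 : 𝔴 (v + w) (a⊹i⊹i) (a⊹j) (a⊹i) a = 0 := faceW_zero_d i i j hji hji rfl rfl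
  have w4 : 𝔴 (v + w) (a⊹i⊹j) (a⊹j) (a⊹i) a = 𝔯 (v + w) * 𝔟 (v + w) (-s) := faceW_two j i
  have w5 : 𝔴 v (a⊹i⊹i⊹j) (a⊹j⊹i) (a⊹i⊹j) (a⊹j) = 𝔯 v := faceW_one i
  have w6 : 𝔴 w (a⊹i⊹i⊹j) (a⊹i⊹j) (a⊹i⊹i) (a⊹i) = 𝔯 w * 𝔟 w (-s - 1) := faceW_two j i
  rw [w0, w1, w2, w3, w4, w5, w6]
  linear_combination 𝔯 (v + w) * 𝔯 v * 𝔯 w *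
    ybe_112_211 G.H s v w G.d0 G.d1 G.d2 z0 z1

lemma case_121_112 (G : Gen x r v w) (ha : a ∈ PLat n) {i j : Fin n} (T : Pair x r a i j) :
    YBE x r n v w a (a⊹i) (a⊹i⊹j)
      (a⊹i⊹j⊹i) (a⊹i⊹i) (a⊹i) := by
  obtain ⟨hij, hji, s, hs, z0, z1⟩ := T
  refine YBE_ne_ne hij hji ha ?_
  have w0 : 𝔴 (v + w) (a⊹i⊹j⊹i) (a⊹i⊹i) (a⊹i⊹j) (a⊹i) = 𝔯 (v + w) * 𝔟 (v + w) (s + 1) := faceW_two i j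
  have w1 : 𝔴 v (a⊹i⊹j) (a⊹i) (a⊹i) a = 𝔯 v * 𝔠 v s := faceW_three i j
  have w2 : 𝔴 w (a⊹i⊹i) (a⊹i) (a⊹i) a = 𝔯 w := faceW_one i
  have w3 : 𝔴 w (a⊹i⊹i) (a⊹i) (a⊹j) a = 0 := faceW_zero_b i i j hji hji rfl rfl
  have w4 : 𝔴 (v + w) (a⊹i⊹j) (a⊹i) (a⊹i) a = 𝔯 (v + w) * 𝔠 (v + w) s := faceW_three i j
  have w5 : 𝔴 v (a⊹i⊹j⊹i) (a⊹i⊹i) (a⊹i⊹j) (a⊹i) = 𝔯 v * 𝔟 v (s + 1) := faceW_two i j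
  have w6 : 𝔴 w (a⊹i⊹j⊹i) (a⊹i⊹j) (a⊹i⊹j) (a⊹i) = 𝔯 w * 𝔠 w (-s - 1) := faceW_three j i
  have w7 : 𝔴 (v + w) (a⊹i⊹i) (a⊹i) (a⊹i) a = 𝔯 (v + w) := faceW_one i
  have w8 : 𝔴 v (a⊹i⊹j⊹i) (a⊹i⊹i) (a⊹i⊹i) (a⊹i) = 𝔯 v * 𝔠 v (s + 1) := faceW_three i j
  have w9 : 𝔴 w (a⊹i⊹j⊹i) (a⊹i⊹i) (a⊹i⊹j) (a⊹i) = 𝔯 w * 𝔟 w (s + 1) := faceW_two i j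
  rw [w0, w1, w2, w3, w4, w5, w6, w7, w8, w9]
  linear_combination 𝔯 (v + w) * 𝔯 v * 𝔯 w *
    ybe_121_112 G.H s v w G.d0 G.d1 G.d2 z0 z1

lemma case_121_121 (G : Gen x r v w) (ha : a ∈ PLat n) {i j : Fin n} (T : Pair x r a i j) :
    YBE x r n v w a (a⊹i) (a⊹i⊹j)
      (a⊹i⊹j⊹i) (a⊹i⊹j) (a⊹i) := by
  obtain ⟨hij, hji, s, hs, z0, z1⟩ := T
  refine YBE_ne_ne hij hji ha ?_
  have w0 : 𝔴 (v + w) (a⊹i⊹j⊹i) (a⊹i⊹j) (a⊹i⊹j) (a⊹i) = 𝔯 (v + w) * 𝔠 (v + w) (-s - 1) := faceW_three j i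
  have w1 : 𝔴 v (a⊹i⊹j) (a⊹i) (a⊹i) a = 𝔯 v * 𝔠 v s := faceW_three i j
  have w2 : 𝔴 w (a⊹i⊹j) (a⊹i) (a⊹i) a = 𝔯 w * 𝔠 w s := faceW_three i j
  have w3 : 𝔴 (v + w) (a⊹i⊹j⊹i) (a⊹i⊹j) (a⊹i⊹j) (a⊹j) = 𝔯 (v + w) := faceW_one i
  have w4 : 𝔴 v (a⊹i⊹j) (a⊹j) (a⊹i) a = 𝔯 v * 𝔟 v (-s) := faceW_two j i
  have w5 : 𝔴 w (a⊹i⊹j) (a⊹i) (a⊹j) a = 𝔯 w * 𝔟 w s := faceW_two i j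
  have w6 : 𝔴 (v + w) (a⊹i⊹j) (a⊹i) (a⊹i) a = 𝔯 (v + w) * 𝔠 (v + w) s := faceW_three i j
  have w7 : 𝔴 v (a⊹i⊹j⊹i) (a⊹i⊹j) (a⊹i⊹j) (a⊹i) = 𝔯 v * 𝔠 v (-s - 1) := faceW_three j i
  have w8 : 𝔴 w (a⊹i⊹j⊹i) (a⊹i⊹j) (a⊹i⊹j) (a⊹i) = 𝔯 w * 𝔠 w (-s - 1) := faceW_three j i
  have w9 : 𝔴 (v + w) (a⊹i⊹i) (a⊹i) (a⊹i) a = 𝔯 (v + w) := faceW_one i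
  have w10 : 𝔴 v (a⊹i⊹j⊹i) (a⊹i⊹j) (a⊹i⊹i) (a⊹i) = 𝔯 v * 𝔟 v (-s - 1) := faceW_two j i
  have w11 : 𝔴 w (a⊹i⊹j⊹i) (a⊹i⊹i) (a⊹i⊹j) (a⊹i) = 𝔯 w * 𝔟 w (s + 1) := faceW_two i j
  rw [w0, w1, w2, w3, w4, w5, w6, w7, w8, w9, w10, w11]
  linear_combination 𝔯 (v + w) * 𝔯 v * 𝔯 w *
    ybe_121_121 G.H s v w G.d0 G.d1 G.d2 z0 z1

lemma case_121_211 (G : Gen x r v w) (ha : a ∈ PLat n) {i j : Fin n} (T : Pair x r a i j) :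
    YBE x r n v w a (a⊹i) (a⊹i⊹j)
      (a⊹i⊹j⊹i) (a⊹j⊹i) (a⊹j) := by
  obtain ⟨hij, hji, s, hs, z0, z1⟩ := T
  refine YBE_ne_ne hij hji ha ?_
  have w0 : 𝔴 (v + w) (a⊹i⊹j⊹i) (a⊹j⊹i) (a⊹i⊹j) (a⊹i) = 𝔯 (v + w) * 𝔠 (v + w) (-s - 1) := faceW_three j i
  have w1 : 𝔴 v (a⊹i⊹j) (a⊹i) (a⊹i) a = 𝔯 v * 𝔠 v s := faceW_three i j
  have w2 : 𝔴 w (a⊹j⊹i) (a⊹j) (a⊹i) a = 𝔯 w * 𝔟 w (-s) := faceW_two j i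
  have w3 : 𝔴 (v + w) (a⊹i⊹j⊹i) (a⊹j⊹i) (a⊹i⊹j) (a⊹j) = 𝔯 (v + w) := faceW_one i
  have w4 : 𝔴 v (a⊹i⊹j) (a⊹j) (a⊹i) a = 𝔯 v * 𝔟 v (-s) := faceW_two j i
  have w5 : 𝔴 w (a⊹j⊹i) (a⊹j) (a⊹j) a = 𝔯 w * 𝔠 w (-s) := faceW_three j i
  have w6 : 𝔴 (v + w) (a⊹i⊹j) (a⊹j) (a⊹i) a = 𝔯 (v + w) * 𝔟 (v + w) (-s) := faceW_two j i
  have w7 : 𝔴 v (a⊹i⊹j⊹i) (a⊹j⊹i) (a⊹i⊹j) (a⊹j) = 𝔯 v := faceW_one i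
  have w8 : 𝔴 w (a⊹i⊹j⊹i) (a⊹i⊹j) (a⊹i⊹j) (a⊹i) = 𝔯 w * 𝔠 w (-s - 1) := faceW_three j i
  have w9 : 𝔴 (v + w) (a⊹i⊹i) (a⊹j) (a⊹i) a = 0 := faceW_zero_d i i j hji hji rfl rfl
  rw [w0, w1, w2, w3, w4, w5, w6, w7, w8, w9]
  linear_combination 𝔯 (v + w) * 𝔯 v * 𝔯 w *
    ybe_121_211 G.H s v w G.d0 G.d1 G.d2 z0 z1

lemma case_211_112 (G : Gen x r v w) (ha : a ∈ PLat n) {i j : Fin n} (T : Pair x r a i j) :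
    YBE x r n v w a (a⊹j) (a⊹j⊹i)
      (a⊹j⊹i⊹i) (a⊹i⊹i) (a⊹i) := by
  obtain ⟨hij, hji, s, hs, z0, z1⟩ := T
  refine YBE_ne_eq hji ha ?_
  have w0 : 𝔴 w (a⊹i⊹i) (a⊹i) (a⊹j) a = 0 := faceW_zero_b i i j hji hji rfl rfl
  have w1 : 𝔴 (v + w) (a⊹j⊹i⊹i) (a⊹i⊹i) (a⊹j⊹i) (a⊹i) = 𝔯 (v + w) * 𝔟 (v + w) (s + 1) := faceW_two i j
  have w2 : 𝔴 v (a⊹j⊹i) (a⊹i) (a⊹j) a = 𝔯 v * 𝔟 v s := faceW_two i j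
  have w3 : 𝔴 w (a⊹i⊹i) (a⊹i) (a⊹i) a = 𝔯 w := faceW_one i
  have w4 : 𝔴 (v + w) (a⊹j⊹i) (a⊹i) (a⊹j) a = 𝔯 (v + w) * 𝔟 (v + w) s := faceW_two i j
  have w5 : 𝔴 v (a⊹j⊹i⊹i) (a⊹i⊹i) (a⊹j⊹i) (a⊹i) = 𝔯 v * 𝔟 v (s + 1) := faceW_two i j
  have w6 : 𝔴 w (a⊹j⊹i⊹i) (a⊹j⊹i) (a⊹j⊹i) (a⊹j) = 𝔯 w := faceW_one i
  rw [w0, w1, w2, w3, w4, w5, w6]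
  linear_combination 𝔯 (v + w) * 𝔯 v * 𝔯 w *
    ybe_211_112 G.H s v w G.d0 G.d1 G.d2 z0 z1

lemma case_211_121 (G : Gen x r v w) (ha : a ∈ PLat n) {i j : Fin n} (T : Pair x r a i j) :
    YBE x r n v w a (a⊹j) (a⊹j⊹i)
      (a⊹j⊹i⊹i) (a⊹i⊹j) (a⊹i) := by
  obtain ⟨hij, hji, s, hs, z0, z1⟩ := T
  refine YBE_ne_eq hji ha ?_
  have w0 : 𝔴 (v + w) (a⊹j⊹i⊹i) (a⊹i⊹j) (a⊹j⊹i) (a⊹j) = 𝔯 (v + w) := faceW_one i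
  have w1 : 𝔴 v (a⊹j⊹i) (a⊹j) (a⊹j) a = 𝔯 v * 𝔠 v (-s) := faceW_three j i
  have w2 : 𝔴 w (a⊹i⊹j) (a⊹i) (a⊹j) a = 𝔯 w * 𝔟 w s := faceW_two i j
  have w3 : 𝔴 (v + w) (a⊹j⊹i⊹i) (a⊹i⊹j) (a⊹j⊹i) (a⊹i) = 𝔯 (v + w) * 𝔠 (v + w) (-s - 1) := faceW_three j i
  have w4 : 𝔴 v (a⊹j⊹i) (a⊹i) (a⊹j) a = 𝔯 v * 𝔟 v s := faceW_two i j
  have w5 : 𝔴 w (a⊹i⊹j) (a⊹i) (a⊹i) a = 𝔯 w * 𝔠 w s := faceW_three i j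
  have w6 : 𝔴 (v + w) (a⊹j⊹i) (a⊹i) (a⊹j) a = 𝔯 (v + w) * 𝔟 (v + w) s := faceW_two i j
  have w7 : 𝔴 v (a⊹j⊹i⊹i) (a⊹i⊹j) (a⊹j⊹i) (a⊹i) = 𝔯 v * 𝔠 v (-s - 1) := faceW_three j i
  have w8 : 𝔴 w (a⊹j⊹i⊹i) (a⊹j⊹i) (a⊹j⊹i) (a⊹j) = 𝔯 w := faceW_one i
  rw [w0, w1, w2, w3, w4, w5, w6, w7, w8]
  linear_combination 𝔯 (v + w) * 𝔯 v * 𝔯 w *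
    ybe_211_121 G.H s v w G.d0 G.d1 G.d2 z0 z1

lemma case_211_211 (G : Gen x r v w) (ha : a ∈ PLat n) {i j : Fin n} (T : Pair x r a i j) :
    YBE x r n v w a (a⊹j) (a⊹j⊹i)
      (a⊹j⊹i⊹i) (a⊹j⊹i) (a⊹j) := by
  obtain ⟨hij, hji, s, hs, z0, z1⟩ := T
  refine YBE_ne_eq hji ha ?_
  have w0 : 𝔴 (v + w) (a⊹j⊹i⊹i) (a⊹j⊹i) (a⊹j⊹i) (a⊹j) = 𝔯 (v + w) := faceW_one i
  have w1 : 𝔴 v (a⊹j⊹i) (a⊹j) (a⊹j) a = 𝔯 v * 𝔠 v (-s) := faceW_three j i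
  have w2 : 𝔴 w (a⊹j⊹i) (a⊹j) (a⊹j) a = 𝔯 w * 𝔠 w (-s) := faceW_three j i
  have w3 : 𝔴 (v + w) (a⊹j⊹i⊹i) (a⊹j⊹i) (a⊹j⊹i) (a⊹i) = 𝔯 (v + w) * 𝔠 (v + w) (-s - 1) := faceW_three j i
  have w4 : 𝔴 v (a⊹j⊹i) (a⊹i) (a⊹j) a = 𝔯 v * 𝔟 v s := faceW_two i j
  have w5 : 𝔴 w (a⊹j⊹i) (a⊹j) (a⊹i) a = 𝔯 w * 𝔟 w (-s) := faceW_two j i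
  have w6 : 𝔴 (v + w) (a⊹j⊹i) (a⊹j) (a⊹j) a = 𝔯 (v + w) * 𝔠 (v + w) (-s) := faceW_three j i
  have w7 : 𝔴 v (a⊹j⊹i⊹i) (a⊹j⊹i) (a⊹j⊹i) (a⊹j) = 𝔯 v := faceW_one i
  have w8 : 𝔴 w (a⊹j⊹i⊹i) (a⊹j⊹i) (a⊹j⊹i) (a⊹j) = 𝔯 w := faceW_one i
  rw [w0, w1, w2, w3, w4, w5, w6, w7, w8]
  linear_combination 𝔯 (v + w) * 𝔯 v * 𝔯 w *
    ybe_211_211 G.H s v w G.d0 G.d1 G.d2 z0 z1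

end cases

/-- If some summand on either side is nonzero, the outer hexagon is admissible. -/
lemma YBE_of_not_adm {x r : ℝ} {n : ℕ} {v w : ℂ} {a b c d e f : Fin n → ℝ}
    (h : ¬ ((∃ i, b = a + ebar n i) ∧ (∃ i, c = b + ebar n i) ∧ (∃ i, d = c + ebar n i) ∧
      (∃ i, f = a + ebar n i) ∧ (∃ i, e = f + ebar n i) ∧ (∃ i, d = e + ebar n i))) :
    YBE x r n v w a b c d e f := by
  have hL (g : Fin n → ℝ) : lhsF x r n v w a b c d e f g = 0 := by
    by_contra h0
    have h3 := faceW_adm (right_ne_zero_of_mul h0)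
    have h2 := faceW_adm (right_ne_zero_of_mul (left_ne_zero_of_mul h0))
    have h1 := faceW_adm (left_ne_zero_of_mul (left_ne_zero_of_mul h0))
    exact h ⟨h2.2.1, h2.2.2.2, h1.2.2.2, h3.1, h3.2.2.1, h1.2.2.1⟩
  have hR (g : Fin n → ℝ) : rhsF x r n v w a b c d e f g = 0 := by
    by_contra h0
    have h3 := faceW_adm (right_ne_zero_of_mul h0)
    have h2 := faceW_adm (right_ne_zero_of_mul (left_ne_zero_of_mul h0))
    have h1 := faceW_adm (left_ne_zero_of_mul (left_ne_zero_of_mul h0))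
    exact h ⟨h1.2.1, h3.2.1, h3.2.2.2, h1.1, h2.1, h2.2.2.1⟩
  simp only [YBE, hL, hR]

lemma Pair.mk' {x r : ℝ} {n : ℕ} {a : Fin n → ℝ} {i j : Fin n} (hij : i ≠ j)
    (h0 : ebrk x r ((abar n a i - abar n a j : ℝ) : ℂ) ≠ 0)
    (h1 : ebrk x r ((abar n (a + ebar n i) i - abar n (a + ebar n i) j : ℝ) : ℂ) ≠ 0) :
    Pair x r a i j := by
  refine ⟨hij, hij.symm, _, rfl, ?_, h0⟩
  rw [abar_add] at h1
  simpa [hij.symm] using h1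

/-- The Yang-Baxter equation at an admissible hexagon. -/
lemma YBE_adm {x r : ℝ} {n : ℕ} {v w : ℂ} (G : Gen x r v w) {a : Fin n → ℝ} (ha : a ∈ PLat n)
    (i j k l m o : Fin n)
    (hE : ebar n i + ebar n j + ebar n k = ebar n l + ebar n m + ebar n o)
    (ra : ∀ μ ν : Fin n, μ ≠ ν → ebrk x r ((abar n a μ - abar n a ν : ℝ) : ℂ) ≠ 0)
    (rb : ∀ κ, (κ = i ∨ κ = j) → ∀ μ ν : Fin n, μ ≠ ν →
      ebrk x r ((abar n (a + ebar n κ) μ - abar n (a + ebar n κ) ν : ℝ) : ℂ) ≠ 0) :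
    YBE x r n v w a (a + ebar n i) (a + ebar n i + ebar n j)
      (a + ebar n i + ebar n j + ebar n k) (a + ebar n l + ebar n m) (a + ebar n l) := by
  have hlm := ebar_three hE
  by_cases hij : i = j
  · subst hij
    by_cases hik : i = k
    · subst hik
      have : l = i ∧ m = i := by tauto
      obtain ⟨rfl, rfl⟩ := this
      exact case_iii ha
    · have P : Pair x r a i k := Pair.mk' hik (ra i k hik) (rb i (Or.inl rfl) i k hik)
      rcases hlm with ⟨rfl, rfl⟩ | ⟨rfl, rfl⟩ | ⟨rfl, rfl⟩ | ⟨rfl, rfl⟩ | ⟨rfl, rfl⟩ | ⟨rfl, rfl⟩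
      · exact case_112_112 G ha P
      · exact case_112_121 G ha P
      · exact case_112_112 G ha P
      · exact case_112_121 G ha P
      · exact case_112_211 G ha P
      · exact case_112_211 G ha P
  · by_cases hik : i = k
    · subst hik
      have P : Pair x r a i j := Pair.mk' hij (ra i j hij) (rb i (Or.inl rfl) i j hij)
      rcases hlm with ⟨rfl, rfl⟩ | ⟨rfl, rfl⟩ | ⟨rfl, rfl⟩ | ⟨rfl, rfl⟩ | ⟨rfl, rfl⟩ | ⟨rfl, rfl⟩
      · exact case_121_121 G ha P
      · exact case_121_112 G ha P
      · exact case_121_211 G ha P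
      · exact case_121_211 G ha P
      · exact case_121_112 G ha P
      · exact case_121_121 G ha P
    · by_cases hjk : j = k
      · subst hjk
        have P : Pair x r a j i := Pair.mk' (Ne.symm hij) (ra j i (Ne.symm hij))
          (rb j (Or.inr rfl) j i (Ne.symm hij))
        rcases hlm with ⟨rfl, rfl⟩ | ⟨rfl, rfl⟩ | ⟨rfl, rfl⟩ | ⟨rfl, rfl⟩ | ⟨rfl, rfl⟩ | ⟨rfl, rfl⟩
        · exact case_211_211 G ha P
        · exact case_211_211 G ha P
        · exact case_211_121 G ha P
        · exact case_211_112 G ha P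
        · exact case_211_121 G ha P
        · exact case_211_112 G ha P
      · have D : Distinct x r a i j k := by
          refine ⟨hij, Ne.symm hij, hjk, Ne.symm hjk, hik, Ne.symm hik, _, _, rfl, rfl, ?_,
            ra i j hij, ra j k hjk⟩
          have := ra i k hik
          rwa [← Complex.ofReal_add, sub_add_sub_cancel]
        rcases hlm with ⟨rfl, rfl⟩ | ⟨rfl, rfl⟩ | ⟨rfl, rfl⟩ | ⟨rfl, rfl⟩ | ⟨rfl, rfl⟩ | ⟨rfl, rfl⟩
        · exact case_123_123 G ha D
        · exact case_123_132 G ha D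
        · exact case_123_213 G ha D
        · exact case_123_231 G ha D
        · exact case_123_312 G ha D
        · exact case_123_321 G ha D

/-- Yang–Baxter equation for the `A^{(1)}_{n-1}` face weights, for states in the weight
lattice `P` and generic spectral parameters (encoded by the non-vanishing of the
elliptic factors occurring in the weights).  Both sums over `g ∈ P` are finite since
`W` vanishes on non-admissible configurations. -/
theorem face_yang_baxter (n : ℕ) (hn : 2 ≤ n) (ε x r : ℝ) (hε : 0 < ε)
    (hx : x = Real.exp (-ε)) (hr : (n : ℝ) - 1 < r)
    (a b c d e f : Fin n → ℝ) (ha : a ∈ PLat n) (hb : b ∈ PLat n) (hc : c ∈ PLat n)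
    (hd : d ∈ PLat n) (he : e ∈ PLat n) (hf : f ∈ PLat n) (v₁ v₂ : ℂ)
    (hgen1 : ebrk x r (1 - v₁) ≠ 0) (hgen2 : ebrk x r (1 - v₂) ≠ 0)
    (hgen3 : ebrk x r (1 - (v₁ - v₂)) ≠ 0)
    (hreg : ∀ p : Fin n → ℝ, (p = a ∨ p = b ∨ p = f ∨ ∃ κ : Fin n, p + ebar n κ = c) →
      ∀ μ ν : Fin n, μ ≠ ν → ebrk x r ((abar n p μ - abar n p ν : ℝ) : ℂ) ≠ 0) :
    ∑' g : PLat n,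
        faceW x r n v₁ d e c g * faceW x r n v₂ c g b a * faceW x r n (v₁ - v₂) e f g a =
      ∑' g : PLat n,
        faceW x r n v₁ g f b a * faceW x r n v₂ d e g f * faceW x r n (v₁ - v₂) d g c b := by
  have hr0 : 0 < r := by
    have : (2 : ℝ) ≤ n := by exact_mod_cast hn
    linarith
  subst hx
  have H := ebrk_isBracket ε r hε hr0 _ hgen1
  obtain ⟨w, rfl⟩ : ∃ w, v₁ = v₂ + w := ⟨v₁ - v₂, by ring⟩
  rw [add_sub_cancel_left] at hgen3 ⊢
  have G : Gen (Real.exp (-ε)) r v₂ w := by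
    refine ⟨H, ?_, ?_, ?_⟩
    · rwa [← neg_ne_zero, ← H.odd, neg_sub]
    · rwa [← neg_ne_zero, ← H.odd, neg_sub]
    · rwa [← neg_ne_zero, ← H.odd, neg_sub]
  change YBE (Real.exp (-ε)) r n v₂ w a b c d e f
  by_cases hadm : (∃ i, b = a + ebar n i) ∧ (∃ i, c = b + ebar n i) ∧ (∃ i, d = c + ebar n i) ∧
      (∃ i, f = a + ebar n i) ∧ (∃ i, e = f + ebar n i) ∧ (∃ i, d = e + ebar n i)
  · obtain ⟨⟨i, rfl⟩, ⟨j, rfl⟩, ⟨k, rfl⟩, ⟨l, rfl⟩, ⟨m, rfl⟩, ⟨o, hE⟩⟩ := hadm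
    refine YBE_adm G ha i j k l m o ?_ (hreg a (Or.inl rfl)) ?_
    · apply add_left_cancel (a := a)
      simpa only [add_assoc] using hE
    · rintro κ (rfl | rfl)
      · exact hreg _ (Or.inr (Or.inl rfl))
      · exact hreg _ (Or.inr (Or.inr (Or.inr ⟨i, by abel⟩)))
  · exact YBE_of_not_adm hadm

end
end

section
/- Elliptic vanishing sum (residue identity): let n ≥ 2, let w_0, …, w_{n−1} ∈ ℂ satisfy [w_κ − w_λ] ≠ 0 for all κ ≠ λ, and let u_0, …, u_n ∈ ℂ satisfy u_n = u_0 + n/2 and [u_{j+1} − u_j − 1/2] ≠ 0 for all 0 ≤ j ≤ n−1. Then Σ_{ν=0}^{n−1} ∏_{j=0, j≠ν}^{n−1} f(u_{j+1} − u_j, 1 − (w_ν − w_j)) / [w_ν − w_j] = 0, where f(v,w) = [v + 1/2 − w]/[v − 1/2]; equivalently Σ_{ν=0}^{n−1} ∏_{j≠ν} [u_{j+1} − u_j − 1/2 + w_ν − w_j] / ([u_{j+1} − u_j − 1/2] · [w_ν − w_j]) = 0. -/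
noncomputable section

/-- `f(v,w) = [v + 1/2 - w]/[v - 1/2]`. -/
def fEll (x r : ℝ) (v w : ℂ) : ℂ := ebrk x r (v + 1 / 2 - w) / ebrk x r (v - 1 / 2)

namespace EllAux
open Filter Topology

/-- The residue sum. -/
def resSum (E : ℂ → ℂ) {n : ℕ} (w b : Fin n → ℂ) : ℂ :=
  ∑ ν, (∏ j, E (w ν - b j)) / ∏ j, (if j = ν then 1 else E (w ν - w j))

theorem resSum_cancel (E : ℂ → ℂ) (h0 : E 0 = 0) {n : ℕ} (w b : Fin (n + 1) → ℂ)
    (hw : ∀ κ l, κ ≠ l → E (w κ - w l) ≠ 0) (k : Fin (n + 1)) (hb : b 0 = w k) :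
    resSum E w b = resSum E (fun i => w (k.succAbove i)) (fun i => b i.succ) := by
  unfold resSum
  rw [Fin.sum_univ_succAbove _ k]
  have h1 : ∏ j, E (w k - b j) = 0 :=
    Finset.prod_eq_zero (Finset.mem_univ 0) (by rw [hb, sub_self, h0])
  rw [h1, zero_div, zero_add]
  refine Finset.sum_congr rfl fun ν _ => ?_
  rw [Fin.prod_univ_succ, Fin.prod_univ_succAbove _ k, hb,
    if_neg (Fin.succAbove_ne k ν).symm]
  rw [mul_div_mul_left _ _ (hw _ _ (Fin.succAbove_ne k ν))]
  congr 1
  refine Finset.prod_congr rfl fun j _ => ?_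
  simp

theorem three_term (E f g : ℂ → ℂ)
    (hE : ∀ a b, E (a + b) * E (a - b) = f a * g b - g a * f b)
    (b0 b1 c0 c1 d0 d1 : ℂ) (hc : c0 + c1 = b0 + b1) (hd : d0 + d1 = b0 + b1) :
    ∃ A B : ℂ, ∀ t, E (d0 - c0) * E (d0 - c1) * (E (t - b0) * E (t - b1)) =
      A * (E (t - c0) * E (t - c1)) + B * (E (t - d0) * E (t - d1)) := by
  set s := (b0 + b1) / 2 with hs
  have key : ∀ t p0 p1 : ℂ, p0 + p1 = b0 + b1 →
      E (t - p0) * E (t - p1) = f (t - s) * g (p1 - s) - g (t - s) * f (p1 - s) := by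
    intro t p0 p1 hp
    rw [← hE]
    have e : p0 = 2 * s - p1 := by rw [hs]; linear_combination hp
    congr 2
    · rw [e]; ring
    · ring
  have hd1 : d0 - s = -(d1 - s) := by rw [hs]; linear_combination hd
  refine ⟨E (d0 - b0) * E (d0 - b1), ?_⟩
  have key2 : ∀ t, E (t - d0) * E (t - d1) = f (t - s) * g (d0 - s) - g (t - s) * f (d0 - s) := by
    intro t
    rw [mul_comm]
    exact key t d1 d0 (by rw [add_comm]; exact hd)
  refine ⟨f (b1 - s) * g (c1 - s) - g (b1 - s) * f (c1 - s), fun t => ?_⟩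
  rw [key2, key d0 c0 c1 hc, key t b0 b1 rfl, key d0 b0 b1 rfl, key t c0 c1 hc]
  ring

theorem resSum_eq_zero (E f g : ℂ → ℂ)
    (hE : ∀ a b, E (a + b) * E (a - b) = f a * g b - g a * f b)
    (hodd : ∀ v, E (-v) = - E v) (hcont : Continuous E)
    (hne : ∀ c : ℂ, ∃ᶠ δ in 𝓝 (0 : ℂ), E (c + δ) ≠ 0) :
    ∀ (n : ℕ) (w b : Fin n → ℂ), (∀ κ l, κ ≠ l → E (w κ - w l) ≠ 0) →
      ∑ j, b j = ∑ j, w j → resSum E w b = 0 := by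
  have h0 : E 0 = 0 := by
    have := hodd 0
    rw [neg_zero] at this
    linear_combination this / 2
  intro n
  induction n with
  | zero => intro w b _ _; simp [resSum]
  | succ n ih =>
    intro w b hw hsum
    match n, ih, w, b, hw, hsum with
    | 0, _, w, b, hw, hsum =>
      simp at hsum
      simp [resSum, hsum, h0]
    | 1, _, w, b, hw, hsum =>
      simp [Fin.sum_univ_two] at hsum
      have hn : E (w 1 - w 0) = - E (w 0 - w 1) := by rw [← hodd]; congr 1; ring
      simp only [resSum, Fin.sum_univ_two, Fin.prod_univ_two]
      have e1 : E (w 0 - b 1) = - E (w 1 - b 0) := by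
        rw [← hodd]; congr 1; linear_combination -hsum
      have e2 : E (w 1 - b 1) = - E (w 0 - b 0) := by
        rw [← hodd]; congr 1; linear_combination -hsum
      have := hw 0 1 (by simp)
      simp [e1, e2, hn]
      field_simp
      ring
    | (m + 2), ih, w, b, hw, hsum =>
      have step : ∀ b : Fin (m + 3) → ℂ, ∑ j, b j = ∑ j, w j →
          E (w 1 + w 0 - b 0 - b 1) * resSum E w b = 0 := by
        intro b hsum
        obtain ⟨A, B, hAB⟩ := three_term E f g hE (b 0) (b 1) (w 0) (b 0 + b 1 - w 0) (w 1)
          (b 0 + b 1 - w 1) (by ring) (by ring)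
        have van : ∀ k : Fin (m + 3), resSum E w
            (Fin.cons (w k) (Fin.cons (b 0 + b 1 - w k) fun j => b j.succ.succ)) = 0 := by
          intro k
          rw [resSum_cancel E h0 w _ hw k (by simp)]
          refine ih _ _ (fun κ l hkl => hw _ _ (by simpa using hkl)) ?_
          have h1 := Fin.sum_univ_succAbove w k
          rw [← hsum, Fin.sum_univ_succ, Fin.sum_univ_succ] at h1
          rw [Fin.sum_univ_succ]
          simp only [Fin.cons_succ, Fin.cons_zero]
          simp only [Fin.succ_zero_eq_one] at h1
          linear_combination h1
        have comb : E (w 1 - w 0) * E (w 1 - (b 0 + b 1 - w 0)) * resSum E w b =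
            A * resSum E w (Fin.cons (w 0) (Fin.cons (b 0 + b 1 - w 0) fun j => b j.succ.succ))
            + B * resSum E w
              (Fin.cons (w 1) (Fin.cons (b 0 + b 1 - w 1) fun j => b j.succ.succ)) := by
          unfold resSum
          rw [Finset.mul_sum, Finset.mul_sum, Finset.mul_sum, ← Finset.sum_add_distrib]
          refine Finset.sum_congr rfl fun ν _ => ?_
          have pr : ∀ c : Fin (m + 3) → ℂ, ∏ j, E (w ν - c j) =
              E (w ν - c 0) * (E (w ν - c 1) * ∏ j : Fin (m + 1), E (w ν - c j.succ.succ)) := by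
            intro c
            rw [Fin.prod_univ_succ, Fin.prod_univ_succ]
            rfl
          have c1 : ∀ (p q : ℂ) (c : Fin (m + 1) → ℂ),
            (Fin.cons p (Fin.cons q c : Fin (m + 2) → ℂ) : Fin (m + 3) → ℂ) 1 = q :=
            fun _ _ _ => rfl
          simp only [pr, c1, Fin.cons_succ, Fin.cons_zero]
          have := hAB (w ν)
          generalize (∏ j, (if j = ν then 1 else E (w ν - w j))) = D
          generalize (∏ j : Fin (m + 1), E (w ν - b j.succ.succ)) = Q
          linear_combination (Q / D) * this
        rw [van, van, mul_zero, mul_zero, add_zero, mul_assoc] at comb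
        have := (mul_eq_zero.mp comb).resolve_left (hw 1 0 (by simp))
        rw [← this]; congr 2; ring
      obtain ⟨i2, h20, h21⟩ : ∃ i : Fin (m + 3), i ≠ 0 ∧ i ≠ 1 :=
        ⟨(0 : Fin (m + 1)).succ.succ, Fin.succ_ne_zero _, fun h =>
          Fin.succ_ne_zero _ (Fin.succ_injective _ (h.trans Fin.succ_zero_eq_one.symm))⟩
      set bb : ℂ → Fin (m + 3) → ℂ := fun δ => b + δ • (Pi.single i2 1 - Pi.single 0 1) with hbb
      have hc : Continuous fun δ => resSum E w (bb δ) := by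
        unfold resSum
        refine continuous_finsetSum _ fun ν _ => Continuous.div_const ?_ _
        refine continuous_finsetProd _ fun j _ => hcont.comp ?_
        simp only [hbb, Pi.add_apply, Pi.smul_apply, smul_eq_mul]
        fun_prop
      have hz : ∃ᶠ δ in 𝓝 (0 : ℂ), resSum E w (bb δ) = 0 := by
        refine (hne (w 1 + w 0 - b 0 - b 1)).mono fun δ hδ => ?_
        have hs : ∑ j, bb δ j = ∑ j, w j := by
          rw [← hsum]
          simp only [hbb, Pi.add_apply, Pi.smul_apply, smul_eq_mul, Finset.sum_add_distrib,
            ← Finset.mul_sum, Pi.sub_apply, Finset.sum_sub_distrib]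
          simp
        refine (mul_eq_zero.mp (step (bb δ) hs)).resolve_left ?_
        have e0 : bb δ 0 = b 0 - δ := by
          simp [hbb, Pi.single_apply, h20.symm]; ring
        have e1 : bb δ 1 = b 1 := by simp [hbb, Pi.single_apply, h21.symm]
        rw [e0, e1]
        convert hδ using 2; ring
      have hmem := (isClosed_singleton (x := (0:ℂ))).preimage hc |>.mem_of_frequently_of_tendsto
        (f := id) hz tendsto_id
      have : resSum E w (bb 0) = 0 := hmem
      simpa [hbb] using this

end EllAux

namespace EllAux
open Filter Topology

/-- Coefficients of the finite q-product `∏_{k<M} (1 - z q^k)`. -/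
def qcoef (q : ℂ) : ℕ → ℕ → ℂ
  | 0, 0 => 1
  | 0, _ + 1 => 0
  | M + 1, 0 => qcoef q M 0
  | M + 1, j + 1 => qcoef q M (j + 1) - q ^ M * qcoef q M j

theorem qcoef_zero (q : ℂ) (M : ℕ) : qcoef q M 0 = 1 := by
  induction M with
  | zero => simp [qcoef]
  | succ M ih => simp [qcoef, ih]

theorem qcoef_gt (q : ℂ) (M : ℕ) : ∀ j, M < j → qcoef q M j = 0 := by
  induction M with
  | zero =>
    intro j hj
    obtain ⟨j, rfl⟩ := Nat.exists_eq_succ_of_ne_zero hj.ne'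
    simp [qcoef]
  | succ M ih =>
    intro j hj
    obtain ⟨j, rfl⟩ := Nat.exists_eq_succ_of_ne_zero (by omega : j ≠ 0)
    simp [qcoef, ih (j + 1) (by omega), ih j (by omega)]

theorem qprod_eq (q z : ℂ) (M : ℕ) :
    ∏ k ∈ Finset.range M, (1 - z * q ^ k) = ∑ j ∈ Finset.range (M + 1), qcoef q M j * z ^ j := by
  induction M with
  | zero => simp [qcoef]
  | succ M ih =>
    rw [Finset.prod_range_succ, ih, Finset.sum_range_succ' _ (M + 1)]
    have h1 : ∑ j ∈ Finset.range (M + 1), qcoef q (M + 1) (j + 1) * z ^ (j + 1) =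
        ∑ j ∈ Finset.range (M + 1), qcoef q M (j + 1) * z ^ (j + 1)
        - z * q ^ M * ∑ j ∈ Finset.range (M + 1), qcoef q M j * z ^ j := by
      rw [Finset.mul_sum, ← Finset.sum_sub_distrib]
      refine Finset.sum_congr rfl fun j _ => ?_
      simp only [qcoef]; ring
    have h2 := Finset.sum_range_succ' (fun j => qcoef q M j * z ^ j) (M + 1)
    rw [Finset.sum_range_succ, qcoef_gt q M (M + 1) (by omega)] at h2
    rw [h1, qcoef_zero]
    rw [qcoef_zero] at h2
    linear_combination h2

/-- finite `(q;q)_n` -/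
def qfac (q : ℝ) (n : ℕ) : ℝ := ∏ k ∈ Finset.range n, (1 - q ^ (k + 1))

theorem qfac_succ (q : ℝ) (n : ℕ) : qfac q (n + 1) = qfac q n * (1 - q ^ (n + 1)) := by
  simp [qfac, Finset.prod_range_succ]

theorem qcoef_closed (q : ℝ) (M : ℕ) : ∀ i j, i + j = M →
    qcoef q M j * qfac q j * qfac q i = (-1) ^ j * (q : ℂ) ^ (j.choose 2) * qfac q M := by
  induction M with
  | zero =>
    intro i j h
    obtain rfl : i = 0 := by omega
    obtain rfl : j = 0 := by omega
    simp [qcoef, qfac]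
  | succ M ih =>
    intro i j h
    match i, j, h with
    | i, 0, h =>
      obtain rfl : i = M + 1 := by omega
      simp [qcoef_zero, qfac]
    | 0, j + 1, h =>
      obtain rfl : j = M := by omega
      have := ih 0 j (by omega)
      simp only [qcoef, qcoef_gt (q : ℂ) j (j + 1) (by omega), qfac_succ]
      rw [Nat.choose_succ_succ, Nat.choose_one_right]
      push_cast
      rw [pow_add]
      linear_combination (-(q:ℂ) ^ j * (1 - q ^ (j + 1))) * this
    | i + 1, j + 1, h =>
      obtain rfl : M = i + j + 1 := by omega
      have h1 := ih i (j + 1) (by omega)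
      have h2 := ih (i + 1) j (by omega)
      have hrec : qcoef q (i + j + 1 + 1) (j + 1) = qcoef q (i + j + 1) (j + 1) -
        (q : ℂ) ^ (i + j + 1) * qcoef q (i + j + 1) j := rfl
      rw [hrec]
      rw [Nat.choose_succ_succ, Nat.choose_one_right] at h1 ⊢
      rw [qfac_succ q (i + j + 1)]
      have e1 := qfac_succ q i
      have e2 := qfac_succ q j
      have e1' : (qfac q (i + 1) : ℂ) = qfac q i * (1 - q ^ (i + 1)) := by rw [e1]; push_cast; rfl
      have e2' : (qfac q (j + 1) : ℂ) = qfac q j * (1 - q ^ (j + 1)) := by rw [e2]; push_cast; rfl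
      rw [e1'] at h2 ⊢
      rw [e2'] at h1 ⊢
      push_cast
      linear_combination (1 - (q:ℂ) ^ (i + 1)) * h1 - (q:ℂ) ^ (i + j + 1) * (1 - q ^ (j + 1)) * h2

theorem qfac_pos {q : ℝ} (h0 : 0 < q) (h1 : q < 1) (n : ℕ) : 0 < qfac q n :=
  Finset.prod_pos fun k _ => sub_pos.2 (pow_lt_one₀ h0.le h1 (by omega))

theorem qfac_anti {q : ℝ} (h0 : 0 < q) (h1 : q < 1) : Antitone (qfac q) := by
  refine antitone_nat_of_succ_le fun n => ?_
  rw [qfac_succ]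
  have := qfac_pos h0 h1 n
  have h2 : 0 < q ^ (n + 1) := by positivity
  nlinarith

theorem multipliable_q (q z : ℂ) (hq : ‖q‖ < 1) : Multipliable fun k : ℕ => (1 - z * q ^ k) := by
  simp_rw [sub_eq_add_neg]
  apply multipliable_one_add_of_summable
  simp only [norm_neg, norm_mul, norm_pow]
  exact (summable_geometric_of_lt_one (norm_nonneg _) hq).mul_left _

theorem qPoch_ne {q : ℝ} (h0 : 0 < q) (h1 : q < 1) : qPochC q q ≠ 0 := by
  unfold qPochC
  simp_rw [sub_eq_add_neg]
  apply tprod_one_add_ne_zero_of_summable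
  · intro i
    have : (q * q ^ i : ℝ) < 1 := by
      rw [← pow_succ']; exact pow_lt_one₀ h0.le h1 (by omega)
    rw [← sub_eq_add_neg]
    have h2 : (1 - q * q ^ i : ℝ) ≠ 0 := by linarith
    exact_mod_cast h2
  · simp only [norm_neg, norm_mul, norm_pow]
    exact (summable_geometric_of_lt_one (norm_nonneg _) (by simpa [abs_of_pos h0] using h1)).mul_left _

theorem qfac_tendsto {q : ℝ} (h0 : 0 < q) (h1 : q < 1) :
    Tendsto (fun n => (qfac q n : ℂ)) atTop (𝓝 (qPochC q q)) := by
  have := (multipliable_q q q (by simpa [abs_of_pos h0] using h1)).hasProd.tendsto_prod_nat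
  refine this.congr fun n => ?_
  simp [qfac, pow_succ']

/-- theta series term -/
def tterm (p z : ℂ) (n : ℤ) : ℂ := (-1) ^ n * p ^ (n * (n - 1)) * z ^ n

/-- finite weights -/
def fwt (q : ℝ) (N : ℕ) (n : ℤ) : ℝ :=
  if n.natAbs ≤ N then qfac q (2 * N) * qfac q N / (qfac q (N + n).toNat * qfac q (N - n).toNat)
  else 0

theorem fwt_nonneg {q : ℝ} (h0 : 0 < q) (h1 : q < 1) (N : ℕ) (n : ℤ) : 0 ≤ fwt q N n := by
  unfold fwt
  split_ifs
  · have := qfac_pos h0 h1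
    exact div_nonneg (mul_nonneg (this _).le (this _).le) (mul_nonneg (this _).le (this _).le)
  · exact le_rfl

theorem fwt_le {q : ℝ} (h0 : 0 < q) (h1 : q < 1) (N : ℕ) (n : ℤ) : fwt q N n ≤ 1 := by
  unfold fwt
  split_ifs with h
  · have hp := qfac_pos h0 h1
    have ha := qfac_anti h0 h1
    rw [div_le_one (mul_pos (hp _) (hp _))]
    rcases le_total 0 n with hn | hn
    · exact mul_le_mul (ha (by omega)) (ha (by omega)) (hp _).le (hp _).le
    · rw [mul_comm (qfac q (N + n).toNat)]
      exact mul_le_mul (ha (by omega)) (ha (by omega)) (hp _).le (hp _).le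
  · exact zero_le_one

theorem fwt_tendsto {q : ℝ} (h0 : 0 < q) (h1 : q < 1) (n : ℤ) :
    Tendsto (fun N => (fwt q N n : ℂ)) atTop (𝓝 1) := by
  have hL := qPoch_ne h0 h1
  have ht := qfac_tendsto h0 h1
  have a1 : Tendsto (fun N : ℕ => 2 * N) atTop atTop :=
    tendsto_atTop_mono (fun N => show N ≤ 2 * N by omega) tendsto_id
  have a2 : Tendsto (fun N : ℕ => ((N : ℤ) + n).toNat) atTop atTop :=
    tendsto_atTop.2 fun b => by
      filter_upwards [eventually_ge_atTop (b + n.natAbs)] with N hN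
      omega
  have a3 : Tendsto (fun N : ℕ => ((N : ℤ) - n).toNat) atTop atTop :=
    tendsto_atTop.2 fun b => by
      filter_upwards [eventually_ge_atTop (b + n.natAbs)] with N hN
      omega
  have := ((ht.comp a1).mul ht).div ((ht.comp a2).mul (ht.comp a3)) (mul_ne_zero hL hL)
  rw [div_self (mul_ne_zero hL hL)] at this
  refine this.congr' ?_
  filter_upwards [eventually_ge_atTop n.natAbs] with N hN
  simp [fwt, hN]

theorem choose_two_zpow (p : ℂ) (j : ℕ) : (p ^ 2) ^ (j.choose 2) = p ^ ((j : ℤ) * (j - 1)) := by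
  rw [← pow_mul, ← zpow_natCast]
  congr 1
  have h := Nat.triangle_succ
  induction j with
  | zero => simp
  | succ j ih =>
    rw [Nat.choose_succ_succ, Nat.choose_one_right]
    push_cast at ih ⊢
    linear_combination ih

theorem refl_prod (p z : ℂ) (hp : p ≠ 0) (hz : z ≠ 0) (N : ℕ) :
    ∏ k ∈ Finset.range N, (1 - z * (p ^ 2) ^ (-(N : ℤ)) * (p ^ 2) ^ k) =
      (-1) ^ N * z ^ N * p ^ (-((N : ℤ) * (N + 1))) *
        ∏ k ∈ Finset.range N, (1 - p ^ 2 * z⁻¹ * (p ^ 2) ^ k) := by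
  rw [← Finset.prod_range_reflect]
  have h1 : ∏ k ∈ Finset.range N, (1 - z * (p ^ 2) ^ (-(N : ℤ)) * (p ^ 2) ^ (N - 1 - k)) =
      ∏ k ∈ Finset.range N, ((-1) * z * p ^ (-2 * ((k : ℤ) + 1)) *
        (1 - p ^ 2 * z⁻¹ * (p ^ 2) ^ k)) := by
    refine Finset.prod_congr rfl fun k hk => ?_
    have hk := Finset.mem_range.1 hk
    have e1 : (p ^ 2) ^ (-(N : ℤ)) * (p ^ 2) ^ (N - 1 - k) = p ^ (-2 * ((k : ℤ) + 1)) := by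
      rw [← zpow_natCast (p ^ 2) (N - 1 - k), ← zpow_add₀ (pow_ne_zero _ hp), ← zpow_natCast p 2, ← zpow_mul]
      congr 1
      push_cast [Nat.cast_sub (by omega : k ≤ N - 1), Nat.cast_sub (by omega : 1 ≤ N)]
      ring
    have e2 : p ^ (-2 * ((k : ℤ) + 1)) * (p ^ 2 * (p ^ 2) ^ k) = 1 := by
      rw [← pow_succ', ← pow_mul, ← zpow_natCast, ← zpow_add₀ hp]
      push_cast
      rw [show -2 * ((k : ℤ) + 1) + 2 * (k + 1) = 0 by ring, zpow_zero]
    rw [mul_assoc z, e1]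
    have e3 : z * z⁻¹ = 1 := mul_inv_cancel₀ hz
    linear_combination -e2 - p ^ (-2 * ((k : ℤ) + 1)) * (p ^ 2 * (p ^ 2) ^ k) * e3
  rw [h1, Finset.prod_mul_distrib]
  congr 1
  clear h1
  induction N with
  | zero => simp
  | succ N ih =>
    rw [Finset.prod_range_succ, ih]
    rw [show -(((N + 1 : ℕ) : ℤ) * (((N + 1 : ℕ) : ℤ) + 1)) = -((N : ℤ) * (N + 1)) + -2 * (N + 1) by
      push_cast; ring, zpow_add₀ hp]
    ring

theorem finite_triple (p : ℝ) (hp0 : 0 < p) (hp1 : p < 1) (z : ℂ) (hz : z ≠ 0) (N : ℕ) :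
    (∏ k ∈ Finset.range N, (1 - z * ((p : ℂ) ^ 2) ^ k)) *
      (∏ k ∈ Finset.range N, (1 - (p : ℂ) ^ 2 * z⁻¹ * ((p : ℂ) ^ 2) ^ k)) * qfac (p ^ 2) N =
    ∑' n : ℤ, (fwt (p ^ 2) N n : ℂ) * tterm p z n := by
  have hp : (p : ℂ) ≠ 0 := by exact_mod_cast hp0.ne'
  have hq0 : 0 < p ^ 2 := by positivity
  have hq1 : p ^ 2 < 1 := pow_lt_one₀ hp0.le hp1 (by norm_num)
  let emb : ℕ ↪ ℤ := ⟨fun j => (j : ℤ) - N, fun a b h => by simpa using h⟩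
  have hemb : ∀ j : ℕ, emb j = (j : ℤ) - N := fun _ => rfl
  rw [tsum_eq_sum (s := (Finset.range (2 * N + 1)).map emb)]
  swap
  · intro n hn
    have : ¬ n.natAbs ≤ N := by
      intro h
      apply hn
      simp only [Finset.mem_map, Finset.mem_range]
      exact ⟨(n + N).toNat, by omega, by rw [hemb]; omega⟩
    simp [fwt, this]
  rw [Finset.sum_map]
  have h1 := qprod_eq ((p : ℂ) ^ 2) (z * ((p : ℂ) ^ 2) ^ (-(N : ℤ))) (2 * N)
  rw [two_mul, Finset.prod_range_add, refl_prod p z hp hz, ← two_mul] at h1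
  have h2 : ∏ k ∈ Finset.range N, (1 - z * ((p : ℂ) ^ 2) ^ (-(N : ℤ)) * ((p : ℂ) ^ 2) ^ (N + k)) =
      ∏ k ∈ Finset.range N, (1 - z * ((p : ℂ) ^ 2) ^ k) := by
    refine Finset.prod_congr rfl fun k _ => ?_
    have : ((p : ℂ) ^ 2) ^ (-(N : ℤ)) * ((p : ℂ) ^ 2) ^ N = 1 := by
      rw [zpow_neg, zpow_natCast]
      exact inv_mul_cancel₀ (pow_ne_zero _ (pow_ne_zero _ hp))
    rw [pow_add]
    linear_combination (-z * ((p : ℂ) ^ 2) ^ k) * this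
  rw [h2] at h1
  set X := ∏ k ∈ Finset.range N, (1 - z * ((p : ℂ) ^ 2) ^ k)
  set Y := ∏ k ∈ Finset.range N, (1 - (p : ℂ) ^ 2 * z⁻¹ * ((p : ℂ) ^ 2) ^ k)
  set c : ℂ := (-1) ^ N * z ^ N * (p : ℂ) ^ (-((N : ℤ) * (N + 1))) with hc
  have hc0 : c ≠ 0 := by
    simp [hc, hz, hp, zpow_ne_zero]
  have h3 : c * (X * Y * qfac (p ^ 2) N) = qfac (p ^ 2) N *
      ∑ j ∈ Finset.range (2 * N + 1), qcoef ((p : ℂ) ^ 2) (2 * N) j *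
        (z * ((p : ℂ) ^ 2) ^ (-(N : ℤ))) ^ j := by
    rw [← h1]; ring
  apply mul_left_cancel₀ hc0
  rw [h3, Finset.mul_sum, Finset.mul_sum]
  refine Finset.sum_congr rfl fun j hj => ?_
  have hj := Finset.mem_range.1 hj
  have h4 := qcoef_closed (p ^ 2) (2 * N) (2 * N - j) j (by omega)
  have hf : fwt (p ^ 2) N (emb j) = qfac (p ^ 2) (2 * N) * qfac (p ^ 2) N /
      (qfac (p ^ 2) j * qfac (p ^ 2) (2 * N - j)) := by
    have e1 : (emb j).natAbs ≤ N := by rw [hemb]; omega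
    have e2 : ((N : ℤ) + emb j).toNat = j := by rw [hemb]; omega
    have e3 : ((N : ℤ) - emb j).toNat = 2 * N - j := by rw [hemb]; omega
    rw [fwt, if_pos e1, e2, e3]
  rw [hf]
  have q1 : (qfac (p ^ 2) j : ℂ) ≠ 0 := by exact_mod_cast (qfac_pos hq0 hq1 j).ne'
  have q2 : (qfac (p ^ 2) (2 * N - j) : ℂ) ≠ 0 := by
    exact_mod_cast (qfac_pos hq0 hq1 (2 * N - j)).ne'
  push_cast at h4 ⊢
  rw [choose_two_zpow] at h4
  have h5 : qcoef ((p : ℂ) ^ 2) (2 * N) j = (-1) ^ j * (p : ℂ) ^ ((j : ℤ) * (j - 1)) *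
      qfac (p ^ 2) (2 * N) / (qfac (p ^ 2) j * qfac (p ^ 2) (2 * N - j)) := by
    rw [eq_div_iff (mul_ne_zero q1 q2), ← h4]; ring
  rw [h5]
  have key : (-1 : ℂ) ^ j * (p : ℂ) ^ ((j : ℤ) * (j - 1)) * (z * ((p : ℂ) ^ 2) ^ (-(N : ℤ))) ^ j =
      c * tterm p z (emb j) := by
    have ee : emb j = (j : ℤ) - N := rfl
    rw [hc, tterm, ee, mul_pow]
    have g1 : (-1 : ℂ) ^ N * (-1) ^ ((j : ℤ) - N) = (-1) ^ j := by
      rw [← zpow_natCast, ← zpow_natCast, ← zpow_add₀ (by norm_num)]; congr 1; ring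
    have g2 : z ^ N * z ^ ((j : ℤ) - N) = z ^ j := by
      rw [← zpow_natCast, ← zpow_natCast, ← zpow_add₀ hz]; congr 1; ring
    have g3 : (p : ℂ) ^ ((j : ℤ) * (j - 1)) * (((p : ℂ) ^ 2) ^ (-(N : ℤ))) ^ j =
        (p : ℂ) ^ (-((N : ℤ) * (N + 1))) * (p : ℂ) ^ (((j : ℤ) - N) * (j - N - 1)) := by
      rw [← zpow_natCast (p : ℂ) 2, ← zpow_natCast _ j, ← zpow_mul, ← zpow_mul, ← zpow_add₀ hp,
        ← zpow_add₀ hp]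
      congr 1; push_cast; ring
    rw [← g1, ← g2]
    linear_combination ((-1 : ℂ) ^ N * (-1) ^ ((j : ℤ) - N) * (z ^ N * z ^ ((j : ℤ) - N))) * g3
  linear_combination ((qfac (p ^ 2) (2 * N) : ℂ) * qfac (p ^ 2) N /
    (qfac (p ^ 2) j * qfac (p ^ 2) (2 * N - j))) * key

theorem triple (p : ℝ) (hp0 : 0 < p) (hp1 : p < 1) (z : ℂ) (hz : z ≠ 0)
    (hs : Summable (tterm p z)) :
    thetaC ((p : ℂ) ^ 2) z = ∑' n, tterm p z n := by
  have hq0 : 0 < p ^ 2 := by positivity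
  have hq1 : p ^ 2 < 1 := pow_lt_one₀ hp0.le hp1 (by norm_num)
  have hn : ‖(p : ℂ) ^ 2‖ < 1 := by
    rw [norm_pow, Complex.norm_real, Real.norm_eq_abs, abs_of_pos hp0]; exact hq1
  have l1 := ((multipliable_q _ z hn).hasProd.tendsto_prod_nat.mul
    (multipliable_q _ ((p : ℂ) ^ 2 * z⁻¹) hn).hasProd.tendsto_prod_nat).mul (qfac_tendsto hq0 hq1)
  have l2 : Tendsto (fun N => ∑' n : ℤ, (fwt (p ^ 2) N n : ℂ) * tterm p z n) atTop
      (𝓝 (∑' n, tterm p z n)) := by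
    refine tendsto_tsum_of_dominated_convergence hs.norm (fun n => ?_) (.of_forall fun N n => ?_)
    · simpa using (fwt_tendsto hq0 hq1 n).mul_const (tterm p z n)
    · rw [norm_mul, Complex.norm_real, Real.norm_eq_abs, abs_of_nonneg (fwt_nonneg hq0 hq1 N n)]
      exact mul_le_of_le_one_left (norm_nonneg _) (fwt_le hq0 hq1 N n)
  have := tendsto_nhds_unique (l1.congr fun N => finite_triple p hp0 hp1 z hz N) l2
  rw [← this]
  simp [thetaC, qPochC]

end EllAux

namespace EllAux
open Filter Topology Complex

theorem xpow (ε : ℝ) (s : ℂ) : ((Real.exp (-ε) : ℝ) : ℂ) ^ s = cexp (-ε * s) := by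
  rw [Complex.cpow_def_of_ne_zero (by exact_mod_cast (Real.exp_pos _).ne'), ← Complex.ofReal_log
    (Real.exp_pos _).le, Real.log_exp]
  push_cast; rfl

theorem neg_one_zpow_exp (n : ℤ) : (-1 : ℂ) ^ n = cexp (n * (Real.pi * I)) := by
  rw [Complex.exp_int_mul, Complex.exp_pi_mul_I]

/-- parameter of the theta function -/
def tauP (ε r : ℝ) : ℂ := I * ((ε * r / Real.pi : ℝ) : ℂ)

theorem tauP_im {ε r : ℝ} (hε : 0 < ε) (hr : 0 < r) : 0 < (tauP ε r).im := by
  have : 0 < ε * r / Real.pi := by have := Real.pi_pos; positivity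
  simpa [tauP] using this

/-- elliptic variable -/
def zP (ε r : ℝ) (v : ℂ) : ℂ := (ε * r - 2 * ε * v + Real.pi * I) / (2 * Real.pi * I)

theorem tterm_eq (ε r : ℝ) (v : ℂ) (n : ℤ) :
    tterm ((Real.exp (-ε * r) : ℝ) : ℂ) (cexp (-ε * (2 * v))) n =
      jacobiTheta₂_term n (zP ε r v) (tauP ε r) := by
  have hpi : (Real.pi : ℂ) ≠ 0 := by exact_mod_cast Real.pi_ne_zero
  have hI : I ≠ 0 := I_ne_zero
  rw [tterm, neg_one_zpow_exp, jacobiTheta₂_term, Complex.ofReal_exp, ← Complex.exp_int_mul,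
    ← Complex.exp_int_mul, ← Complex.exp_add, ← Complex.exp_add]
  congr 1
  rw [zP, tauP]
  push_cast
  field_simp
  linear_combination (- (n : ℂ) ^ 2 * ε * r) * I_sq

theorem ebrk_eq (ε r : ℝ) (hε : 0 < ε) (hr : 0 < r) (v : ℂ) :
    ebrk (Real.exp (-ε)) r v =
      cexp (-ε * (v ^ 2 / r - v)) * jacobiTheta₂ (zP ε r v) (tauP ε r) := by
  unfold ebrk
  rw [xpow, xpow, xpow]
  congr 1
  have h1 : cexp (-ε * ((2 * r : ℝ) : ℂ)) = ((Real.exp (-ε * r) : ℝ) : ℂ) ^ 2 := by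
    rw [Complex.ofReal_exp, ← Complex.exp_nat_mul]; congr 1; push_cast; ring
  have hs : Summable (tterm ((Real.exp (-ε * r) : ℝ) : ℂ) (cexp (-ε * (2 * v)))) := by
    simp_rw [funext (tterm_eq ε r v)]
    exact (summable_jacobiTheta₂_term_iff _ _).2 (tauP_im hε hr)
  rw [h1, triple _ (Real.exp_pos _) (by rw [Real.exp_lt_one_iff]; nlinarith) _
    (Complex.exp_ne_zero _) hs]
  exact tsum_congr (tterm_eq ε r v)

theorem ebrk_diff (ε r : ℝ) (hε : 0 < ε) (hr : 0 < r) :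
    Differentiable ℂ (ebrk (Real.exp (-ε)) r) := by
  rw [funext (ebrk_eq ε r hε hr)]
  refine Differentiable.mul (by fun_prop) fun v => ?_
  have h1 : DifferentiableAt ℂ (zP ε r) v := by unfold zP; fun_prop
  exact (differentiableAt_jacobiTheta₂_fst (zP ε r v) (tauP_im hε hr)).comp v h1

/-- Gaussian form of the terms of the bracket. -/
def eterm (ε r : ℝ) (v : ℂ) (n : ℤ) : ℂ :=
  (-1) ^ n * cexp (-ε * ((v + r * (n - 1 / 2)) ^ 2 / r - r / 4))

theorem ebrk_hasSum (ε r : ℝ) (hε : 0 < ε) (hr : 0 < r) (v : ℂ) :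
    HasSum (eterm ε r v) (ebrk (Real.exp (-ε)) r v) := by
  rw [ebrk_eq ε r hε hr]
  refine ((hasSum_jacobiTheta₂_term (zP ε r v) (tauP_im hε hr)).mul_left _).congr_fun ?_
  intro n
  have hr' : (r : ℂ) ≠ 0 := by exact_mod_cast hr.ne'
  rw [← tterm_eq, tterm, eterm, Complex.ofReal_exp, ← Complex.exp_int_mul,
    ← Complex.exp_int_mul]
  rw [mul_assoc, mul_left_comm, ← Complex.exp_add, ← Complex.exp_add]
  congr 2
  push_cast
  field_simp
  ring

theorem gauss_summable (c r : ℝ) (hc : 0 < c) (hr : 0 < r) (y : ℂ) :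
    Summable fun n : ℤ => cexp (-c * (y + r * n) ^ 2) := by
  have h := ((summable_jacobiTheta₂_term_iff (I * (c * r * y / Real.pi)) (tauP (c * r) r)).2
    (tauP_im (by positivity) hr)).mul_left (cexp (-c * y ^ 2))
  refine h.congr fun n => ?_
  have hpi : (Real.pi : ℂ) ≠ 0 := by exact_mod_cast Real.pi_ne_zero
  rw [jacobiTheta₂_term, ← Complex.exp_add]
  congr 1
  rw [tauP]
  push_cast
  field_simp
  linear_combination (c * (2 * r * y * n + (n : ℂ) ^ 2 * r ^ 2)) * I_sq

/-- odd-type Gaussian term -/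
def g1 (ε r : ℝ) (a : ℂ) (k : ℤ) : ℂ :=
  cexp (-((2 * ε / r : ℝ) : ℂ) * (a - r / 2 + r * k) ^ 2)
/-- even-type Gaussian term -/
def g0 (ε r : ℝ) (a : ℂ) (k : ℤ) : ℂ :=
  cexp (-((2 * ε / r : ℝ) : ℂ) * (a + r * k) ^ 2)

/-- Splitting pairs of integers by parity of the sum. -/
def parEquiv : (ℤ × ℤ) ⊕ (ℤ × ℤ) ≃ ℤ × ℤ where
  toFun := Sum.elim (fun p => (p.1 + p.2, p.1 - p.2)) (fun p => (p.1 + p.2, p.1 - p.2 + 1))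
  invFun p := if (p.1 + p.2) % 2 = 0 then Sum.inl ((p.1 + p.2) / 2, (p.1 - p.2) / 2)
    else Sum.inr ((p.1 + p.2) / 2, (p.1 - p.2 + 1) / 2)
  left_inv := by
    rintro (⟨k, l⟩ | ⟨k, l⟩)
    · have h : (k + l + (k - l)) % 2 = 0 := by omega
      simp only [Sum.elim_inl, h, if_true, Sum.inl.injEq, Prod.mk.injEq]
      omega
    · have h : ¬ (k + l + (k - l + 1)) % 2 = 0 := by omega
      simp only [Sum.elim_inr, h, if_false, Sum.inr.injEq, Prod.mk.injEq]
      omega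
  right_inv := by
    rintro ⟨m, n⟩
    by_cases h : (m + n) % 2 = 0
    · simp only [h, if_true, Sum.elim_inl, Prod.mk.injEq]
      omega
    · simp only [h, if_false, Sum.elim_inr, Prod.mk.injEq]
      omega

theorem ebrk_add (ε r : ℝ) (hε : 0 < ε) (hr : 0 < r) (a b : ℂ) :
    ebrk (Real.exp (-ε)) r (a + b) * ebrk (Real.exp (-ε)) r (a - b) =
      (cexp (ε * r / 2) * ∑' k, g1 ε r a k) * (∑' k, g0 ε r b k) -
      (∑' k, g0 ε r a k) * (cexp (ε * r / 2) * ∑' k, g1 ε r b k) := by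
  have hr' : (r : ℂ) ≠ 0 := by exact_mod_cast hr.ne'
  have H1 := ebrk_hasSum ε r hε hr (a + b)
  have H2 := ebrk_hasSum ε r hε hr (a - b)
  have s0 : ∀ a, Summable (g0 ε r a) := fun a => gauss_summable _ r (by positivity) hr a
  have s1 : ∀ a, Summable (g1 ε r a) := fun a => gauss_summable _ r (by positivity) hr (a - r / 2)
  have H := H1.mul H2 (summable_mul_of_summable_norm H1.summable.norm H2.summable.norm)
  have K1 := ((s1 a).hasSum.mul (s0 b).hasSum
    (summable_mul_of_summable_norm (s1 a).norm (s0 b).norm)).mul_left (cexp (ε * r / 2))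
  have K2 := ((s0 a).hasSum.mul (s1 b).hasSum
    (summable_mul_of_summable_norm (s0 a).norm (s1 b).norm)).mul_left (-cexp (ε * r / 2))
  rw [← parEquiv.hasSum_iff] at H
  have sgn : ∀ k l : ℤ, (-1 : ℂ) ^ (k + l) * (-1) ^ (k - l) = 1 := by
    intro k l
    rw [← zpow_add₀ (by norm_num), show k + l + (k - l) = 2 * k by ring, zpow_mul]
    norm_num
  have K := HasSum.sum (f := (fun x : ℤ × ℤ => eterm ε r (a + b) x.1 * eterm ε r (a - b) x.2) ∘
    parEquiv) (K1.congr_fun ?_) (K2.congr_fun ?_)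
  · rw [H.unique K]; ring
  · rintro ⟨k, l⟩
    simp only [Function.comp, parEquiv, Equiv.coe_fn_mk, Sum.elim_inl, eterm, g1, g0]
    rw [mul_mul_mul_comm, sgn, one_mul, ← Complex.exp_add, ← Complex.exp_add, ← Complex.exp_add]
    congr 1
    push_cast
    field_simp
    ring
  · rintro ⟨k, l⟩
    simp only [Function.comp, parEquiv, Equiv.coe_fn_mk, Sum.elim_inr, eterm, g1, g0]
    rw [zpow_add₀ (by norm_num : (-1 : ℂ) ≠ 0) (k - l) 1,
      mul_mul_mul_comm, ← mul_assoc ((-1 : ℂ) ^ (k + l)), sgn, one_mul, zpow_one, neg_one_mul,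
      neg_mul (cexp (ε * r / 2)), ← Complex.exp_add, ← Complex.exp_add, ← Complex.exp_add]
    congr 2
    push_cast
    field_simp
    ring

end EllAux

/-- Elliptic vanishing (residue) identity:
`Σ_{ν} ∏_{j≠ν} f(u_{j+1}-u_j, 1-(w_ν-w_j)) / [w_ν-w_j] = 0`,
provided `u_n = u_0 + n/2` and the denominators do not vanish. -/
theorem elliptic_vanishing_sum (n : ℕ) (hn : 2 ≤ n) (ε x r : ℝ) (hε : 0 < ε)
    (hx : x = Real.exp (-ε)) (hr : (n : ℝ) - 1 < r)
    (w : Fin n → ℂ) (hw : ∀ κ lam : Fin n, κ ≠ lam → ebrk x r (w κ - w lam) ≠ 0)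
    (u : Fin (n + 1) → ℂ) (hun : u (Fin.last n) = u 0 + (n : ℂ) / 2)
    (hu : ∀ j : Fin n, ebrk x r (u j.succ - u j.castSucc - 1 / 2) ≠ 0) :
    ∑ ν : Fin n, ∏ j ∈ Finset.univ.erase ν,
      (fEll x r (u j.succ - u j.castSucc) (1 - (w ν - w j)) / ebrk x r (w ν - w j)) = 0 := by
  have hr0 : 0 < r := by
    have : (2 : ℝ) ≤ n := by exact_mod_cast hn
    linarith
  subst hx
  set E := ebrk (Real.exp (-ε)) r with hEdef
  have hdiff : Differentiable ℂ E := EllAux.ebrk_diff ε r hε hr0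
  have hadd := EllAux.ebrk_add ε r hε hr0
  rw [← hEdef] at hadd
  obtain ⟨t, ht⟩ : ∃ t, E t ≠ 0 := ⟨_, hu ⟨0, by omega⟩⟩
  have hodd : ∀ v, E (-v) = - E v := by
    intro v
    have h1 := hadd ((t + v) / 2) ((t - v) / 2)
    have h2 := hadd ((t - v) / 2) ((t + v) / 2)
    rw [show (t + v) / 2 + (t - v) / 2 = t by ring, show (t + v) / 2 - (t - v) / 2 = v by ring] at h1
    rw [show (t - v) / 2 + (t + v) / 2 = t by ring, show (t - v) / 2 - (t + v) / 2 = -v by ring] at h2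
    apply mul_left_cancel₀ ht
    linear_combination h1 + h2
  have hne : ∀ c : ℂ, ∃ᶠ δ in nhds (0 : ℂ), E (c + δ) ≠ 0 := by
    intro c hc
    have hA : AnalyticOnNhd ℂ (fun δ => E (c + δ)) Set.univ :=
      DifferentiableOn.analyticOnNhd (hdiff.comp (by fun_prop)).differentiableOn isOpen_univ
    have hz := hA.eqOn_zero_of_preconnected_of_eventuallyEq_zero isPreconnected_univ
      (Set.mem_univ 0) (hc.mono fun δ h => by simpa using h)
    apply ht
    have := hz (Set.mem_univ (t - c))
    simpa using this
  set a : Fin n → ℂ := fun j => u j.succ - u j.castSucc - 1 / 2 with ha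
  have hsum : ∑ j, (w j - a j) = ∑ j, w j := by
    have h1 : ∑ j : Fin n, (u j.succ - u j.castSucc) = u (Fin.last n) - u 0 := by
      have e1 := Fin.sum_univ_succ u
      have e2 := Fin.sum_univ_castSucc u
      rw [Finset.sum_sub_distrib]
      linear_combination e2 - e1
    rw [Finset.sum_sub_distrib]
    simp only [ha]
    rw [Finset.sum_sub_distrib, h1, hun]
    simp
    ring
  have main := EllAux.resSum_eq_zero E _ _ hadd hodd hdiff.continuous hne n w (fun j => w j - a j)
    hw hsum
  have hP : ∏ j, E (a j) ≠ 0 := Finset.prod_ne_zero_iff.2 fun j _ => hu j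
  apply mul_left_cancel₀ hP
  rw [mul_zero, ← main, EllAux.resSum, Finset.mul_sum]
  refine Finset.sum_congr rfl fun ν _ => ?_
  rw [← Finset.mul_prod_erase Finset.univ (fun j => E (a j)) (Finset.mem_univ ν),
    ← Finset.mul_prod_erase Finset.univ (fun j => E (w ν - (w j - a j))) (Finset.mem_univ ν),
    ← Finset.mul_prod_erase Finset.univ (fun j => if j = ν then 1 else E (w ν - w j))
      (Finset.mem_univ ν)]
  rw [if_pos rfl, one_mul, show w ν - (w ν - a ν) = a ν by ring, mul_assoc, mul_div_assoc,
    ← Finset.prod_mul_distrib, ← Finset.prod_div_distrib]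
  congr 1
  refine Finset.prod_congr rfl fun j hj => ?_
  rw [if_neg (Finset.ne_of_mem_erase hj), fEll, ← hEdef]
  have h1 : E (u j.succ - u j.castSucc - 1 / 2) ≠ 0 := hu j
  have h2 : u j.succ - u j.castSucc + 1 / 2 - (1 - (w ν - w j)) = w ν - (w j - a j) := by
    simp only [ha]; ring
  rw [h2]
  change E (a j) * (E (w ν - (w j - a j)) / E (a j) / E (w ν - w j)) = _
  rw [← mul_div_assoc, mul_div_cancel₀ _ (hu j)]

end
end
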